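/- Let g be an infinite game on a countable pruned tree T over a countable set Σ, with two players a and b, outcomes {y, x_1, …, x_n} for some n ≥ 0, strict linear preferences y <_a x_n <_a ⋯ <_a x_1 and y <_b x_1 <_b ⋯ <_b x_n, and Borel-measurable outcome function v. If the set of plays with outcome y is the union of an open subset and a closed subset of [T], then g has a global-Pareto subgame perfect equilibrium. -/

import Mathlib

/-! Basic setup: trees of finite sequences, their branches, the topology on the set of
branches, the Hausdorff difference hierarchy, quasi-difference sets, and infinite
games in extensive form. -/

/-- `T` is a tree over `α`: a set of finite sequences closed under taking prefixes. -/
def IsTree {α : Type*} (T : Set (List α)) : Prop :=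
  ∀ ⦃γ δ : List α⦄, γ <+: δ → δ ∈ T → γ ∈ T

/-- `succ(T, γ)`: the nodes of `T` extending `γ` and of length `|γ| + 1`. -/
def treeSucc {α : Type*} (T : Set (List α)) (γ : List α) : Set (List α) :=
  {δ | δ ∈ T ∧ γ <+: δ ∧ δ.length = γ.length + 1}

/-- `T` is pruned if every node has a successor. -/
def IsPruned {α : Type*} (T : Set (List α)) : Prop :=
  ∀ γ ∈ T, (treeSucc T γ).Nonempty

/-- The finite prefix of length `n` of an infinite sequence `p`. -/
def playPrefix {α : Type*} (p : ℕ → α) (n : ℕ) : List α :=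
  List.ofFn fun i : Fin n => p i

/-- `[T]`: the infinite sequences all of whose finite prefixes lie in `T`. -/
def Body {α : Type*} (T : Set (List α)) : Set (ℕ → α) :=
  {p | ∀ n : ℕ, playPrefix p n ∈ T}

/-- `γ[T_γ]`: the elements of `[T]` extending the node `γ`. -/
def cylinder {α : Type*} (T : Set (List α)) (γ : List α) : Set (ℕ → α) :=
  {p | p ∈ Body T ∧ playPrefix p γ.length = γ}

/-- Open subsets of `[T]`: the unions of basic sets `γ[T_γ]`, `γ ∈ T`. -/
def IsOpenIn {α : Type*} (T : Set (List α)) (A : Set (ℕ → α)) : Prop :=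
  ∃ S ⊆ T, A = ⋃ γ ∈ S, cylinder T γ

/-- Closed subsets of `[T]`: complements in `[T]` of open subsets of `[T]`. -/
def IsClosedIn {α : Type*} (T : Set (List α)) (A : Set (ℕ → α)) : Prop :=
  A ⊆ Body T ∧ IsOpenIn T (Body T \ A)

/-- Borel subsets of `[T]`: members of the σ-algebra generated by the open
subsets of `[T]` that are themselves included in `[T]`. -/
def IsBorelIn {α : Type*} (T : Set (List α)) (X : Set (ℕ → α)) : Prop :=
  X ⊆ Body T ∧
    @MeasurableSet (ℕ → α) (MeasurableSpace.generateFrom {A | IsOpenIn T A}) X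

/-- `D_θ((A_η)_{η<θ})`: the set of `x ∈ ⋃_{η<θ} A_η` such that the least `η < θ`
with `x ∈ A_η` has parity opposite to that of `θ`. -/
noncomputable def Dset {α : Type*} (θ : Ordinal.{0}) (A : Ordinal.{0} → Set (ℕ → α)) :
    Set (ℕ → α) :=
  {x | (∃ η < θ, x ∈ A η) ∧ sInf {η | η < θ ∧ x ∈ A η} % 2 ≠ θ % 2}

/-- `D_θ([T])`: all sets of the form `D_θ((A_η)_{η<θ})` for an `⊆`-increasing family
of open subsets of `[T]`. -/
def Dclass {α : Type*} (T : Set (List α)) (θ : Ordinal.{0}) : Set (Set (ℕ → α)) :=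
  {X | ∃ A : Ordinal.{0} → Set (ℕ → α),
        (∀ η < θ, IsOpenIn T (A η)) ∧
        (∀ η₁ η₂, η₁ ≤ η₂ → η₂ < θ → A η₁ ⊆ A η₂) ∧
        X = Dset θ A}

/-- The quasi-difference sets `𝒟([T])`: open sets, unions of quasi-difference sets
placed below pairwise `⊑`-incomparable nodes, and complements in `[T]`. -/
inductive QuasiDiff {α : Type*} (T : Set (List α)) : Set (ℕ → α) → Prop
  | isOpen : ∀ A, IsOpenIn T A → QuasiDiff T A
  | iUnion : ∀ (S : Set (List α)) (D : List α → Set (ℕ → α)),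
      S ⊆ T → (S.Pairwise fun γ δ => ¬ γ <+: δ) →
      (∀ γ ∈ S, QuasiDiff T (D γ)) →
      (∀ γ ∈ S, D γ ⊆ cylinder T γ) →
      QuasiDiff T (⋃ γ ∈ S, D γ)
  | compl : ∀ A, QuasiDiff T A → QuasiDiff T (Body T \ A)

/-- An infinite game in extensive form: a tree `T` of finite plays, an owner function `d`,
an outcome function `v` on infinite plays, and a preference relation for each player. -/
structure Game (α A O : Type*) where
  T : Set (List α)
  d : List α → A
  v : (ℕ → α) → O
  pref : A → O → O → Prop

/-- The infinite sequence starting with `γ` and continuing with `p`. -/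
def listExtend {α : Type*} (γ : List α) (p : ℕ → α) : ℕ → α :=
  fun n => if h : n < γ.length then γ.get ⟨n, h⟩ else p (n - γ.length)

/-- The subgame `g_γ` of `g` at a node `γ`. -/
def Game.sub {α A O : Type*} (g : Game α A O) (γ : List α) : Game α A O where
  T := {δ | γ ++ δ ∈ g.T}
  d := fun δ => g.d (γ ++ δ)
  v := fun p => g.v (listExtend γ p)
  pref := g.pref

/-- A strategy profile on `T`: it maps each node of `T` to a successor. -/
def IsProfile {α : Type*} (T : Set (List α)) (s : List α → List α) : Prop :=
  ∀ γ ∈ T, s γ ∈ treeSucc T γ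

/-- The sequence of nodes obtained from `γ` by repeatedly applying `s`. -/
def iterNode {α : Type*} (s : List α → List α) (γ : List α) : ℕ → List α
  | 0 => γ
  | n + 1 => s (iterNode s γ n)

/-- The play `p^ε(s)` induced by `s` at the root. -/
def inducedPlay {α : Type*} [Inhabited α] (s : List α → List α) : ℕ → α :=
  fun n => (iterNode s [] (n + 1)).getD n default

/-- The subprofile `s_γ`, defined by `γ s_γ(δ) = s(γδ)`. -/
def subProfile {α : Type*} (γ : List α) (s : List α → List α) : List α → List α :=
  fun δ => (s (γ ++ δ)).drop γ.length

/-- `s` is a Nash equilibrium of `g`: no player `a` has a profitable deviation `s'`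
differing from `s` only at nodes owned by `a`. -/
def IsNE {α A O : Type*} [Inhabited α] (g : Game α A O) (s : List α → List α) : Prop :=
  ¬ ∃ (a : A) (s' : List α → List α), IsProfile g.T s' ∧
      (∀ γ ∈ g.T, s γ ≠ s' γ → g.d γ = a) ∧
      g.pref a (g.v (inducedPlay s)) (g.v (inducedPlay s'))

/-- `s` is a subgame perfect equilibrium of `g`: `s_γ` is an NE of `g_γ` for all `γ ∈ T`. -/
def IsSPE {α A O : Type*} [Inhabited α] (g : Game α A O) (s : List α → List α) : Prop :=
  ∀ γ ∈ g.T, IsNE (g.sub γ) (subProfile γ s)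

/-- The outcomes occurring in `g`. -/
def OutcomesOf {α A O : Type*} (g : Game α A O) : Set O := g.v '' Body g.T

/-- `x ∈ Os` is Pareto-optimal in `Os`. -/
def ParetoOpt {A O : Type*} (pref : A → O → O → Prop) (Os : Set O) (x : O) : Prop :=
  x ∈ Os ∧ ∀ y ∈ Os, ∀ a, pref a x y → ∃ b, pref b y x

/-- The outcome induced by the subprofile `s_γ` in the subgame `g_γ`. -/
def subOutcome {α A O : Type*} [Inhabited α] (g : Game α A O) (s : List α → List α)
    (γ : List α) : O :=
  (g.sub γ).v (inducedPlay (subProfile γ s))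

/-- Global-Pareto SPE: an SPE inducing in every subgame an outcome that is
Pareto-optimal among the outcomes occurring in that subgame. -/
def IsGPSPE {α A O : Type*} [Inhabited α] (g : Game α A O) (s : List α → List α) : Prop :=
  IsSPE g s ∧ ∀ γ ∈ g.T, ParetoOpt g.pref (OutcomesOf (g.sub γ)) (subOutcome g s γ)

/-- An `x`-pseudo-leaf: a shortest node `γ ∈ T` such that only `x` occurs in `g_γ`. -/
def IsPseudoLeaf {α A O : Type*} (g : Game α A O) (x : O) (γ : List α) : Prop :=
  γ ∈ g.T ∧ OutcomesOf (g.sub γ) = {x} ∧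
    ∀ δ, δ <+: γ → δ ≠ γ → OutcomesOf (g.sub δ) ≠ {x}

/-- A strict weak order: irreflexive, transitive, with transitive complement. -/
def IsSWO {O : Type*} (r : O → O → Prop) : Prop :=
  (∀ x, ¬ r x x) ∧ (∀ x y z, r x y → r y z → r x z) ∧
  (∀ x y z, ¬ r x y → ¬ r y z → ¬ r x z)

/-- The SPE killer does not occur in the family of preferences `lt`. -/
def NoSPEKiller {A O : Type*} (lt : A → O → O → Prop) : Prop :=
  ∀ a b : A, ∀ x y z : O, ¬ (lt a z y ∧ lt a y x ∧ lt b x z ∧ lt b z y)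

/-- Player `a`'s preference `y <_a x_n <_a ⋯ <_a x_1`, where `y` is the outcome `0`
and `x_i` is the outcome `i` in `Fin (n+1)`. -/
def prefA (n : ℕ) : Fin (n + 1) → Fin (n + 1) → Prop :=
  fun u v => v ≠ 0 ∧ (u = 0 ∨ v < u)

/-- Player `b`'s preference `y <_b x_1 <_b ⋯ <_b x_n`, where `y` is the outcome `0`
and `x_i` is the outcome `i` in `Fin (n+1)`. -/
def prefB (n : ℕ) : Fin (n + 1) → Fin (n + 1) → Prop :=
  fun u v => u < v

universe u

namespace BD

/-- Game trees: nodes with a length and a parent function.  Plays may get stuck. -/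
structure GT : Type (u+1) where
  N : Type u
  len : N → ℕ
  par : N → N
  root : N
  len_root : len root = 0
  eq_root : ∀ q, len q = 0 → q = root
  len_par : ∀ q, len (par q) = len q - 1

namespace GT
variable (T : GT.{u})

def IsPlay (x : ℕ → T.N) : Prop := (∀ n, T.len (x n) = n) ∧ ∀ n, T.par (x (n+1)) = x n

def Child (q r : T.N) : Prop := T.par r = q ∧ T.len r = T.len q + 1

def Le (u q : T.N) : Prop := ∃ j, T.par^[j] q = u

theorem par_root : T.par T.root = T.root := T.eq_root _ (by rw [T.len_par, T.len_root])

variable {T}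

theorem len_iter (q : T.N) (j : ℕ) : T.len (T.par^[j] q) = T.len q - j := by
  induction j generalizing q with
  | zero => simp
  | succ j ih => rw [Function.iterate_succ_apply, ih, T.len_par]; omega

theorem le_refl (q : T.N) : T.Le q q := ⟨0, rfl⟩

theorem le_len {u q : T.N} (h : T.Le u q) : T.len u ≤ T.len q := by
  obtain ⟨j, rfl⟩ := h; rw [len_iter]; omega

theorem le_cases {u q : T.N} (h : T.Le u q) : u = q ∨ T.Le u (T.par q) := by
  obtain ⟨j, rfl⟩ := h
  cases j with
  | zero => left; rfl
  | succ j => right; exact ⟨j, rfl⟩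

theorem le_of_par {u q : T.N} (h : T.Le u (T.par q)) : T.Le u q := by
  obtain ⟨j, rfl⟩ := h; exact ⟨j+1, rfl⟩

theorem par_le {u q : T.N} (h : T.Le u q) : T.Le (T.par u) q := by
  obtain ⟨j, rfl⟩ := h; exact ⟨j+1, by rw [Function.iterate_succ_apply']⟩

theorem le_eq_iter {u q : T.N} (h : T.Le u q) : T.par^[T.len q - T.len u] q = u := by
  obtain ⟨j, rfl⟩ := h
  rw [len_iter]
  by_cases hj : j ≤ T.len q
  · congr 2; omega
  · rw [T.eq_root (T.par^[j] q) (by rw [len_iter]; omega),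
      T.eq_root (T.par^[_] q) (by rw [len_iter]; omega)]

theorem le_total {u v q : T.N} (h : T.Le u q) (h' : T.Le v q) (hl : T.len u ≤ T.len v) :
    T.Le u v := by
  refine ⟨T.len v - T.len u, ?_⟩
  conv_lhs => rw [← le_eq_iter h', ← Function.iterate_add_apply]
  rw [le_eq_iter h', ← le_eq_iter h]
  have := le_len h'
  congr 2
  rw [le_eq_iter h]; omega

theorem le_antisymm_len {u q : T.N} (h : T.Le u q) (hl : T.len u = T.len q) : u = q := by
  have := le_eq_iter h
  rw [hl] at this; simpa using this.symm

theorem le_trans {u v q : T.N} (h : T.Le u v) (h' : T.Le v q) : T.Le u q := by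
  obtain ⟨j, rfl⟩ := h; obtain ⟨i, rfl⟩ := h'
  exact ⟨j+i, by rw [Function.iterate_add_apply]⟩

theorem exists_anc (q : T.N) (n : ℕ) (h : n ≤ T.len q) : ∃ v, T.Le v q ∧ T.len v = n :=
  ⟨_, ⟨T.len q - n, rfl⟩, by rw [len_iter]; omega⟩

theorem child_par {q : T.N} (h : T.len q ≠ 0) : T.Child (T.par q) q :=
  ⟨rfl, by rw [T.len_par]; omega⟩

theorem IsPlay.le {x : ℕ → T.N} (hx : T.IsPlay x) {i j : ℕ} (h : i ≤ j) : T.Le (x i) (x j) := by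
  induction j, h using Nat.le_induction with
  | base => exact le_refl _
  | succ j _ ih => exact le_of_par (by rw [hx.2]; exact ih)

theorem IsPlay.eq_of_le {x : ℕ → T.N} (hx : T.IsPlay x) {u : T.N} {j : ℕ} (h : T.Le u (x j)) :
    x (T.len u) = u := by
  have h1 := le_len h
  rw [hx.1] at h1
  exact (le_antisymm_len (le_total h (hx.le h1) (by rw [hx.1])) (by rw [hx.1])).symm

theorem IsPlay.child {x : ℕ → T.N} (hx : T.IsPlay x) (n : ℕ) : T.Child (x n) (x (n+1)) :=
  ⟨hx.2 n, by rw [hx.1, hx.1]⟩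

theorem IsPlay.zero {x : ℕ → T.N} (hx : T.IsPlay x) : x 0 = T.root := T.eq_root _ (hx.1 0)

end GT

open BD.GT

def turn (b : Bool) (n : ℕ) : Prop := Even n ↔ b = true

theorem turn_not (b : Bool) (n : ℕ) : turn (!b) n ↔ ¬ turn b n := by
  unfold turn; cases b <;> simp

structure IsStr (T : GT.{u}) (b : Bool) (m : ℕ) (S : Set T.N) : Prop where
  root : T.root ∈ S
  par : ∀ q ∈ S, T.len q ≤ m → T.par q ∈ S
  mine : ∀ q ∈ S, T.len q < m → turn b (T.len q) →
    ∃ r, T.Child q r ∧ r ∈ S ∧ ∀ r', T.Child q r' → r' ∈ S → r' = r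
  opp : ∀ q ∈ S, T.len q < m → ¬ turn b (T.len q) → ∀ r, T.Child q r → r ∈ S

theorem IsStr.congr {T : GT.{u}} {b : Bool} {m : ℕ} {S S' : Set T.N} (h : IsStr T b m S)
    (e : ∀ q, T.len q ≤ m → (q ∈ S ↔ q ∈ S')) : IsStr T b m S' where
  root := (e _ (by rw [T.len_root]; omega)).1 h.root
  par q hq hl := (e _ (by rw [T.len_par]; omega)).1 (h.par q ((e q hl).2 hq) hl)
  mine q hq hl ht := by
    obtain ⟨r, h1, h2, h3⟩ := h.mine q ((e q hl.le).2 hq) hl ht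
    refine ⟨r, h1, (e r (by rw [h1.2]; omega)).1 h2, fun r' hr hr' => h3 r' hr ?_⟩
    exact (e r' (by rw [hr.2]; omega)).2 hr'
  opp q hq hl ht r hr := (e r (by rw [hr.2]; omega)).1 (h.opp q ((e q hl.le).2 hq) hl ht r hr)

theorem IsStr.mono {T : GT.{u}} {b : Bool} {m m' : ℕ} {S : Set T.N} (h : IsStr T b m S)
    (hm : m' ≤ m) : IsStr T b m' S where
  root := h.root
  par q hq hl := h.par q hq (hl.trans hm)
  mine q hq hl ht := h.mine q hq (by omega) ht
  opp q hq hl ht := h.opp q hq (by omega) ht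

structure Hom (T' T : GT.{u}) where
  f : T'.N → T.N
  len : ∀ q, T.len (f q) = T'.len q
  par : ∀ q, T.par (f q) = f (T'.par q)

namespace Hom
def id (T : GT.{u}) : Hom T T := ⟨fun q => q, fun _ => rfl, fun _ => rfl⟩
def comp {T T' T'' : GT.{u}} (g : Hom T' T) (h : Hom T'' T') : Hom T'' T :=
  ⟨fun q => g.f (h.f q), fun q => by rw [g.len, h.len], fun q => by rw [g.par, h.par]⟩
theorem play {T T' : GT.{u}} (g : Hom T' T) {x : ℕ → T'.N} (hx : T'.IsPlay x) :
    T.IsPlay (fun n => g.f (x n)) :=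
  ⟨fun n => by rw [g.len, hx.1], fun n => by rw [g.par, hx.2]⟩
theorem child {T T' : GT.{u}} (g : Hom T' T) {q r : T'.N} (h : T'.Child q r) :
    T.Child (g.f q) (g.f r) := ⟨by rw [g.par, h.1], by rw [g.len, g.len, h.2]⟩
theorem root {T T' : GT.{u}} (g : Hom T' T) : g.f T'.root = T.root :=
  T.eq_root _ (by rw [g.len, T'.len_root])
end Hom

structure Cover (T' T : GT.{u}) (k : ℕ) extends Hom T' T where
  inj : ∀ q q', T'.len q ≤ k → f q = f q' → q = q'
  surj : ∀ q, T.len q ≤ k → ∃ q', f q' = q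
  φ : Bool → Set T'.N → Set T.N
  loc : ∀ b m S S', (∀ q, T'.len q ≤ m → (q ∈ S ↔ q ∈ S')) →
    ∀ q, T.len q ≤ m → (q ∈ φ b S ↔ q ∈ φ b S')
  str : ∀ b m S, IsStr T' b m S → IsStr T b m (φ b S)
  lift : ∀ b S, (∀ m, IsStr T' b m S) → ∀ x, T.IsPlay x → (∀ n, x n ∈ φ b S) →
    ∃ y, T'.IsPlay y ∧ (∀ n, y n ∈ S) ∧ ∀ n, f (y n) = x n
  low : ∀ b S q, T'.len q ≤ k → (f q ∈ φ b S ↔ q ∈ S)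

def Cover.comp {T T' T'' : GT.{u}} {k k' : ℕ} (C : Cover T' T k) (C' : Cover T'' T' k')
    (h : k ≤ k') : Cover T'' T k where
  toHom := C.toHom.comp C'.toHom
  inj q q' hl he := C'.inj q q' (by omega) (C.inj _ _ (by rw [C'.len]; exact hl) he)
  surj q hl := by
    obtain ⟨q', rfl⟩ := C.surj q hl
    obtain ⟨q'', rfl⟩ := C'.surj q' (by rw [C.len] at hl; omega)
    exact ⟨q'', rfl⟩
  φ b S := C.φ b (C'.φ b S)
  loc b m S S' e := C.loc b m _ _ (C'.loc b m S S' e)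
  str b m S hS := C.str b m _ (C'.str b m S hS)
  lift b S hS x hx hxs := by
    obtain ⟨y, hy, hys, hyx⟩ := C.lift b _ (fun m => C'.str b m S (hS m)) x hx hxs
    obtain ⟨z, hz, hzs, hzy⟩ := C'.lift b S hS y hy hys
    exact ⟨z, hz, hzs, fun n => by rw [← hyx, ← hzy]; rfl⟩
  low b S q hl := by
    show C.f (C'.f q) ∈ _ ↔ _
    rw [C.low b _ _ (by rw [C'.len]; exact hl), C'.low b S q (by omega)]

/-! Inverse limits -/
section Limit
variable {k : ℕ} {T : ℕ → GT.{u}} (C : ∀ i, Cover (T (i+1)) (T i) (k+i))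

structure LimN where
  z : ∀ i, (T i).N
  h : ∀ i, (C i).f (z (i+1)) = z i

variable {C}

theorem LimN.len_eq (z : LimN C) (i : ℕ) : (T i).len (z.z i) = (T 0).len (z.z 0) := by
  induction i with
  | zero => rfl
  | succ i ih => rw [← ih, ← z.h i, (C i).len]

theorem LimN.ext' {z z' : LimN C} (h : ∀ i, z.z i = z'.z i) : z = z' := by
  cases z; cases z'; simp only [LimN.mk.injEq]; funext i; exact h i

theorem LimN.uniq {z z' : LimN C} {i : ℕ} (hl : (T i).len (z.z i) ≤ k + i)
    (h : z.z i = z'.z i) : z = z' := by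
  have down : ∀ j d, z.z (j + d) = z'.z (j + d) → z.z j = z'.z j := by
    intro j d
    induction d with
    | zero => exact fun h => h
    | succ d ih => intro h; apply ih; rw [← z.h, ← z'.h]; exact congrArg _ h
  apply LimN.ext'
  intro j
  by_cases hj : j ≤ i
  · obtain ⟨d, rfl⟩ := Nat.exists_eq_add_of_le hj
    exact down j d h
  · have hj' : i ≤ j := by omega
    clear hj
    induction j, hj' using Nat.le_induction with
    | base => exact h
    | succ j hj ih =>
      apply (C j).inj
      · rw [z.len_eq, ← z.len_eq i]; omega
      · rw [z.h, z'.h, ih]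

theorem LimN.exists_of (i : ℕ) (q : (T i).N) (hl : (T i).len q ≤ k + i) :
    ∃ z : LimN C, z.z i = q := by
  classical
  have down : ∀ i (q : (T i).N), ∃ z : ∀ j, (T j).N, z i = q ∧
      ∀ j < i, (C j).f (z (j+1)) = z j := by
    intro i
    induction i with
    | zero => exact fun q => ⟨fun j => if h : j = 0 then h ▸ q else (T j).root, by simp, by simp⟩
    | succ i ih =>
      intro q
      obtain ⟨z, hz, hzz⟩ := ih ((C i).f q)
      refine ⟨Function.update z (i+1) q, by simp, fun j hj => ?_⟩
      rcases Nat.lt_succ_iff_lt_or_eq.1 hj with h | rfl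
      · rw [Function.update_of_ne (by omega), Function.update_of_ne (by omega), hzz j h]
      · rw [Function.update_self, Function.update_of_ne (by omega), hz]
  obtain ⟨z, hz, hzz⟩ := down i q
  have hsec : ∀ j (q : (T j).N), ∃ q', (T j).len q ≤ k + j → (C j).f q' = q := by
    intro j q
    by_cases h : (T j).len q ≤ k + j
    · obtain ⟨q', h'⟩ := (C j).surj q h
      exact ⟨q', fun _ => h'⟩
    · exact ⟨(T (j+1)).root, fun h' => absurd h' h⟩
  choose sec hsec using hsec
  let z' : ∀ j, (T j).N := fun j => Nat.rec (motive := fun j => (T j).N) (z 0)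
    (fun j w => if j < i then z (j+1) else sec j w) j
  have hlow : ∀ j ≤ i, z' j = z j := by
    intro j hj
    cases j with
    | zero => rfl
    | succ j => show (if j < i then z (j+1) else _) = _
                rw [if_pos (by omega)]
  have hhi : ∀ j, i ≤ j → (T j).len (z' j) ≤ k + i ∧ (C j).f (z' (j+1)) = z' j := by
    intro j hj
    have key : ∀ j, i ≤ j → (T j).len (z' j) ≤ k + i → (C j).f (z' (j+1)) = z' j := by
      intro j hj hlen
      have : z' (j+1) = sec j (z' j) := by
        show (if j < i then z (j+1) else _) = _
        rw [if_neg (by omega)]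
      rw [this]; exact hsec _ _ (by omega)
    induction j, hj using Nat.le_induction with
    | base =>
      have h1 : (T i).len (z' i) ≤ k + i := by rw [hlow i le_rfl, hz]; exact hl
      exact ⟨h1, key i le_rfl h1⟩
    | succ j hj ih =>
      have h1 : (T (j+1)).len (z' (j+1)) ≤ k + i := by
        rw [← (C j).len, ih.2]; exact ih.1
      exact ⟨h1, key _ (by omega) h1⟩
  refine ⟨⟨z', fun j => ?_⟩, by show z' i = q; rw [hlow i le_rfl, hz]⟩
  by_cases hj : j < i
  · rw [hlow j hj.le, hlow (j+1) hj, hzz j hj]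
  · exact (hhi j (by omega)).2

variable (C)

def limGT : GT.{u} where
  N := LimN C
  len z := (T 0).len (z.z 0)
  par z := ⟨fun i => (T i).par (z.z i), fun i => by rw [← (C i).par, z.h]⟩
  root := ⟨fun i => (T i).root, fun i => (C i).toHom.root⟩
  len_root := (T 0).len_root
  eq_root z hz := LimN.ext' fun i => (T i).eq_root _ (by rw [z.len_eq]; exact hz)
  len_par z := (T 0).len_par _

def limProj (i : ℕ) : Hom (limGT C) (T i) where
  f z := z.z i
  len z := z.len_eq i
  par _ := rfl

def limQ (S : Set (LimN C)) (i : ℕ) : Set (T i).N := {q | ∃ z ∈ S, z.z i = q}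

def limPsi (b : Bool) (S : Set (LimN C)) : ℕ → ∀ i, Set (T i).N
  | 0, i => limQ C S i
  | d+1, i => (C i).φ b (limPsi b S d (i+1))

def limS (b : Bool) (S : Set (LimN C)) (i : ℕ) : Set (T i).N :=
  {q | q ∈ limPsi C b S ((T i).len q) i}

variable {C}

theorem mem_limQ {S : Set (LimN C)} {i : ℕ} {z : LimN C} (hl : (T i).len (z.z i) ≤ k + i) :
    z.z i ∈ limQ C S i ↔ z ∈ S := by
  constructor
  · rintro ⟨z', h, e⟩
    rwa [LimN.uniq hl e.symm]
  · exact fun h => ⟨z, h, rfl⟩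

theorem limPsi_succ (b : Bool) (S : Set (LimN C)) (d i : ℕ) (q : (T i).N)
    (hl : (T i).len q ≤ k + i + d) : q ∈ limPsi C b S d i ↔ q ∈ limPsi C b S (d+1) i := by
  induction d generalizing i with
  | zero =>
    obtain ⟨z, rfl⟩ := LimN.exists_of (C := C) i q hl
    show _ ∈ limQ C S i ↔ _ ∈ (C i).φ b (limQ C S (i+1))
    rw [mem_limQ hl, ← z.h, (C i).low, mem_limQ]
    · rw [z.len_eq, ← z.len_eq i]; omega
    · rw [z.len_eq, ← z.len_eq i]; omega
  | succ d ih =>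
    exact (C i).loc b (k+i+(d+1)) _ _ (fun q hq => ih (i+1) q (by omega)) q hl

theorem limPsi_iff (b : Bool) (S : Set (LimN C)) (d i : ℕ) (q : (T i).N)
    (hl : (T i).len q ≤ k + i + d) : q ∈ limPsi C b S d i ↔ q ∈ limS C b S i := by
  have key : ∀ d d', d ≤ d' → (T i).len q ≤ k + i + d →
      (q ∈ limPsi C b S d i ↔ q ∈ limPsi C b S d' i) := by
    intro d d' h hl
    induction d', h using Nat.le_induction with
    | base => rfl
    | succ d' h ih => rw [ih, limPsi_succ]; omega
  show _ ↔ q ∈ limPsi C b S ((T i).len q) i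
  rcases le_total d ((T i).len q) with h | h
  · exact key _ _ h hl
  · exact (key _ _ h (by omega)).symm

theorem limS_eq (b : Bool) (S : Set (LimN C)) (i : ℕ) :
    limS C b S i = (C i).φ b (limS C b S (i+1)) := by
  ext q
  rw [← limPsi_iff b S ((T i).len q + 1) i q (by omega)]
  exact (C i).loc b (T i |>.len q) _ _
    (fun q' hq' => limPsi_iff b S _ (i+1) q' (by omega)) q le_rfl

theorem limQ_str {b : Bool} {m i : ℕ} {S : Set (LimN C)} (hS : IsStr (limGT C) b m S)
    (hm : m ≤ k + i) : IsStr (T i) b m (limQ C S i) where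
  root := ⟨_, hS.root, rfl⟩
  par := by
    rintro _ ⟨z, hz, rfl⟩ hl
    exact ⟨_, hS.par z hz (((limProj C i).len z).symm.trans_le hl), rfl⟩
  mine := by
    rintro _ ⟨z, hz, rfl⟩ hl ht
    have hlz : (T i).len (z.z i) = (limGT C).len z := (limProj C i).len z
    rw [hlz] at hl ht
    obtain ⟨r, h1, h2, h3⟩ := hS.mine z hz hl ht
    refine ⟨r.z i, (limProj C i).child h1, ⟨r, h2, rfl⟩, ?_⟩
    rintro _ hc ⟨r', hr', rfl⟩
    rw [h3 r' ⟨?_, ?_⟩ hr']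
    · apply LimN.uniq (i := i) _ hc.1
      show (T i).len ((T i).par _) ≤ _
      rw [hc.1]; omega
    · exact ((limProj C i).len _).symm.trans (hc.2.trans (congrArg (· + 1) hlz))
  opp := by
    rintro _ ⟨z, hz, rfl⟩ hl ht r hc
    have hlz : (T i).len (z.z i) = (limGT C).len z := (limProj C i).len z
    rw [hlz] at hl ht
    obtain ⟨r, rfl⟩ := LimN.exists_of (C := C) i r (by rw [hc.2]; omega)
    refine ⟨r, hS.opp z hz hl ht r ⟨?_, ?_⟩, rfl⟩
    · apply LimN.uniq (i := i) _ hc.1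
      show (T i).len ((T i).par _) ≤ _
      rw [hc.1]; omega
    · exact ((limProj C i).len _).symm.trans (hc.2.trans (congrArg (· + 1) hlz))

theorem limPsi_str {b : Bool} {m : ℕ} {S : Set (LimN C)} (d i : ℕ)
    (h : ∀ j, j = i + d → IsStr (T j) b m (limQ C S j)) :
    IsStr (T i) b m (limPsi C b S d i) := by
  induction d generalizing i with
  | zero => exact h i rfl
  | succ d ih => exact (C i).str b m _ (ih (i+1) (fun j hj => h j (by omega)))

theorem limS_str {b : Bool} {m : ℕ} {S : Set (LimN C)} (hS : IsStr (limGT C) b m S) (i : ℕ) :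
    IsStr (T i) b m (limS C b S i) :=
  (limPsi_str (S := S) m i (fun _ hj => limQ_str hS (by omega))).congr
    (fun q hq => limPsi_iff b S m i q (by omega))

variable (C)

def limCover : Cover (limGT C) (T 0) k where
  toHom := limProj C 0
  inj q q' hl h := LimN.uniq (i := 0) hl h
  surj q hl := LimN.exists_of 0 q hl
  φ b S := limS C b S 0
  loc b m S S' e := by
    have hQ : ∀ i q, (T i).len q ≤ m → (q ∈ limQ C S i ↔ q ∈ limQ C S' i) := by
      intro i q hq
      constructor
      · rintro ⟨z, hz, rfl⟩
        exact ⟨z, (e z (((limProj C i).len z).symm.trans_le hq)).1 hz, rfl⟩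
      · rintro ⟨z, hz, rfl⟩
        exact ⟨z, (e z (((limProj C i).len z).symm.trans_le hq)).2 hz, rfl⟩
    have hP : ∀ d i q, (T i).len q ≤ m → (q ∈ limPsi C b S d i ↔ q ∈ limPsi C b S' d i) := by
      intro d
      induction d with
      | zero => exact hQ
      | succ d ih => exact fun i => (C i).loc b m _ _ (ih (i+1))
    exact fun q hq => hP _ 0 q hq
  str b m S hS := limS_str hS 0
  lift b S hS x hx hxs := by
    have step : ∀ i (w : {x : ℕ → (T i).N // (T i).IsPlay x ∧ ∀ n, x n ∈ limS C b S i}),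
        ∃ y : {x : ℕ → (T (i+1)).N // (T (i+1)).IsPlay x ∧ ∀ n, x n ∈ limS C b S (i+1)},
          ∀ n, (C i).f (y.1 n) = w.1 n := by
      rintro i ⟨w, hw, hws⟩
      obtain ⟨y, h1, h2, h3⟩ := (C i).lift b _ (fun m => limS_str (hS m) (i+1)) w hw
        (fun n => (limS_eq (C := C) b S i) ▸ hws n)
      exact ⟨⟨y, h1, h2⟩, h3⟩
    choose nx hnx using step
    let X : ∀ i, {x : ℕ → (T i).N // (T i).IsPlay x ∧ ∀ n, x n ∈ limS C b S i} :=
      fun i => Nat.rec (motive := fun i => {x : ℕ → (T i).N // (T i).IsPlay x ∧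
        ∀ n, x n ∈ limS C b S i}) ⟨x, hx, hxs⟩ (fun i w => nx i w) i
    refine ⟨fun n => ⟨fun i => (X i).1 n, fun i => hnx i (X i) n⟩, ⟨fun n => ?_, fun n => ?_⟩,
      fun n => ?_, fun n => rfl⟩
    · exact (X 0).2.1.1 n
    · exact LimN.ext' fun i => (X i).2.1.2 n
    · have h1 : (X n).1 n ∈ limS C b S n := (X n).2.2 n
      have hl : (T n).len ((X n).1 n) = n := (X n).2.1.1 n
      rw [← limPsi_iff b S 0 n _ (by omega)] at h1
      exact (mem_limQ (z := ⟨fun i => (X i).1 n, fun i => hnx i (X i) n⟩) (by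
        show (T n).len ((X n).1 n) ≤ _
        omega)).1 h1
  low b S q hl := by
    show q.z 0 ∈ limS C b S 0 ↔ _
    have hl' : (T 0).len (q.z 0) ≤ k := hl
    rw [← limPsi_iff b S 0 0 _ (by omega)]
    exact mem_limQ (by omega)

end Limit

end BD

namespace BD
open BD.GT

/-! Unravelling an open set -/
section Unravel
variable (T : GT.{u}) (D : Set T.N) (K : ℕ)

def EN (u : T.N) : Prop := K + 2 ≤ T.len u ∧ u ∈ D ∧ (T.len u = K + 2 ∨ T.par u ∉ D)

def Legal3 (q : T.N) (W : Set T.N) : Option T.N → Prop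
  | none => (T.len q = K + 2 ∨ T.par q ∉ D) ∧ (q ∈ D → (Odd (T.len q) ↔ q ∈ W))
  | some u => u ∈ W ∧ EN T D K u ∧ (T.Le u q ∨ T.Le q u)

def Legal (q : T.N) (W : Set T.N) (o : Option T.N) : Prop :=
  (T.len q ≤ K → W = ∅) ∧ (T.len q ≤ K + 1 → o = none) ∧ (K + 2 ≤ T.len q → Legal3 T D K q W o)

structure UN where
  q : T.N
  W : Set T.N
  o : Option T.N
  h : Legal T D K q W o

variable {T D K}

theorem EN_uniq (hD : ∀ q, T.par q ∈ D → q ∈ D) {u u' q : T.N} (hu : EN T D K u)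
    (hu' : EN T D K u') (h : T.Le u q) (h' : T.Le u' q) : u = u' := by
  have mono : ∀ u q, T.Le u q → u ∈ D → q ∈ D := by
    rintro u q ⟨j, rfl⟩
    induction j generalizing q with
    | zero => exact fun h => h
    | succ j ih => exact fun h => hD _ (ih _ h)
  have key : ∀ u u', EN T D K u → EN T D K u' → T.Le u q → T.Le u' q →
      T.len u < T.len u' → False := by
    intro u u' hu hu' h h' hl
    rcases le_cases (le_total h h' hl.le) with e | e
    · rw [e] at hl; omega
    · rcases hu'.2.2 with e2 | e2
      · have := hu.1; omega
      · exact e2 (mono _ _ e hu.2.1)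
  rcases lt_trichotomy (T.len u) (T.len u') with e | e | e
  · exact (key u u' hu hu' h h' e).elim
  · exact le_antisymm_len (le_total h h' e.le) e
  · exact (key u' u hu' hu h' h e).elim

theorem D_mono (hD : ∀ q, T.par q ∈ D → q ∈ D) {u q : T.N} (h : T.Le u q) (hu : u ∈ D) :
    q ∈ D := by
  obtain ⟨j, rfl⟩ := h
  induction j generalizing q with
  | zero => exact hu
  | succ j ih => exact hD _ (ih hu)

open Classical in
theorem legal_par (hD : ∀ q, T.par q ∈ D → q ∈ D) {q : T.N} {W : Set T.N} {o : Option T.N}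
    (h : Legal T D K q W o) : Legal T D K (T.par q) (if T.len q ≤ K + 1 then ∅ else W)
      (if T.len q ≤ K + 2 then none else o) := by
  have hl := T.len_par q
  refine ⟨fun h1 => if_pos (by omega), fun h1 => if_pos (by omega), fun h1 => ?_⟩
  have h3 := h.2.2 (by omega)
  rw [if_neg (by omega), if_neg (by omega)]
  cases o with
  | none =>
    have h4 : T.par q ∉ D := by
      rcases h3.1 with e | e
      · omega
      · exact e
    exact ⟨Or.inr (fun h5 => h4 (hD _ h5)), fun h5 => absurd h5 h4⟩
  | some u =>
    refine ⟨h3.1, h3.2.1, ?_⟩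
    rcases h3.2.2 with e | e
    · rcases le_cases e with e | e
      · right; rw [e]; exact par_le (le_refl _)
      · left; exact e
    · right; exact par_le e

variable (T D K) in
open Classical in
def unGT (hD : ∀ q, T.par q ∈ D → q ∈ D) : GT.{u} where
  N := UN T D K
  len z := T.len z.q
  par z := ⟨T.par z.q, if T.len z.q ≤ K + 1 then ∅ else z.W,
    if T.len z.q ≤ K + 2 then none else z.o, legal_par hD z.h⟩
  root := ⟨T.root, ∅, none, fun _ => rfl, fun _ => rfl, fun h => by rw [T.len_root] at h; omega⟩
  len_root := T.len_root
  eq_root z hz := by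
    obtain ⟨q, W, o, h⟩ := z
    have hz' : T.len q = 0 := hz
    have h1 := h.1 (by omega)
    have h2 := h.2.1 (by omega)
    have h3 := T.eq_root q hz'
    subst h1 h2 h3
    rfl
  len_par z := T.len_par _

def Mem (S : Set (UN T D K)) (q : T.N) (W : Set T.N) (o : Option T.N) : Prop :=
  ∃ h : Legal T D K q W o, (⟨q, W, o, h⟩ : UN T D K) ∈ S

variable (hD : ∀ q, T.par q ∈ D → q ∈ D) {S : Set (UN T D K)} {b : Bool} {m : ℕ}

section lemmas

open Classical in
theorem M_par (hS : IsStr (unGT T D K hD) b m S)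
    {q : T.N} {W : Set T.N} {o : Option T.N} (h : Mem S q W o) (hl : T.len q ≤ m) :
    Mem S (T.par q) (if T.len q ≤ K + 1 then ∅ else W) (if T.len q ≤ K + 2 then none else o) :=
  ⟨legal_par hD h.1, hS.par _ h.2 hl⟩

theorem M_par_hi (hS : IsStr (unGT T D K hD) b m S)
    {q : T.N} {W : Set T.N} {o : Option T.N} (h : Mem S q W o) (hl : T.len q ≤ m)
    (h3 : K + 3 ≤ T.len q) : Mem S (T.par q) W o := by
  have := M_par hD hS h hl
  rwa [if_neg (by omega), if_neg (by omega)] at this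

theorem M_par_mid (hS : IsStr (unGT T D K hD) b m S)
    {q : T.N} {W : Set T.N} {o : Option T.N} (h : Mem S q W o) (hl : T.len q ≤ m)
    (h3 : K + 2 ≤ T.len q) (ho : o = none ∨ T.len q = K + 2) : Mem S (T.par q) W none := by
  have := M_par hD hS h hl
  rw [if_neg (by omega)] at this
  rcases ho with rfl | e
  · simpa using this
  · rwa [if_pos (by omega)] at this

open Classical in
theorem M_mine (hS : IsStr (unGT T D K hD) b m S)
    {q : T.N} {W : Set T.N} {o : Option T.N} (h : Mem S q W o) (hl : T.len q < m)
    (ht : turn b (T.len q)) : ∃ r W' o', T.Child q r ∧ Mem S r W' o' ∧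
      W = (if T.len r ≤ K + 1 then ∅ else W') ∧ o = (if T.len r ≤ K + 2 then none else o') ∧
      ∀ r' W'' o'', T.Child q r' → Mem S r' W'' o'' →
        W = (if T.len r' ≤ K + 1 then ∅ else W'') → o = (if T.len r' ≤ K + 2 then none else o'') →
        r' = r ∧ W'' = W' ∧ o'' = o' := by
  obtain ⟨hL, hm⟩ := h
  obtain ⟨⟨r, W', o', hr⟩, h1, h2, h3⟩ := hS.mine _ hm hl ht
  have e1 := h1.1
  simp only [unGT, UN.mk.injEq] at e1
  refine ⟨r, W', o', ⟨e1.1, h1.2⟩, ⟨hr, h2⟩, e1.2.1.symm, e1.2.2.symm, ?_⟩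
  rintro r' W'' o'' hc ⟨hr', hm'⟩ eW eo
  have := h3 ⟨r', W'', o'', hr'⟩ ⟨?_, hc.2⟩ hm'
  · exact UN.mk.inj this
  · simp only [unGT, UN.mk.injEq]
    exact ⟨hc.1, eW.symm, eo.symm⟩

open Classical in
theorem M_opp (hS : IsStr (unGT T D K hD) b m S)
    {q : T.N} {W : Set T.N} {o : Option T.N} (h : Mem S q W o) (hl : T.len q < m)
    (ht : ¬ turn b (T.len q)) {r : T.N} {W' : Set T.N} {o' : Option T.N} (hc : T.Child q r)
    (hL : Legal T D K r W' o') (eW : W = (if T.len r ≤ K + 1 then ∅ else W'))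
    (eo : o = (if T.len r ≤ K + 2 then none else o')) : Mem S r W' o' := by
  obtain ⟨hL', hm⟩ := h
  refine ⟨hL, hS.opp _ hm hl ht _ ⟨?_, hc.2⟩⟩
  simp only [unGT, UN.mk.injEq]
  exact ⟨hc.1, eW.symm, eo.symm⟩

theorem M_down (hS : IsStr (unGT T D K hD) b m S)
    {q q0 : T.N} {W : Set T.N} {o : Option T.N} (h : Mem S q W o) (hl : T.len q ≤ m)
    (h0 : T.len q0 = K + 1) (hle : T.Le q0 q) : Mem S q0 W none := by
  obtain ⟨d, hd⟩ : ∃ d, T.len q = K + 1 + d := ⟨T.len q - (K+1), by have := le_len hle; omega⟩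
  induction d generalizing q o with
  | zero =>
    have := le_antisymm_len hle (by omega)
    subst this
    have := h.1.2.1 (by omega)
    subst this; exact h
  | succ d ih =>
    have hlp := T.len_par q
    have hle' : T.Le q0 (T.par q) := by
      rcases le_cases hle with e | e
      · rw [e] at h0; omega
      · exact e
    by_cases h2 : T.len q = K + 2
    · exact ih (M_par_mid hD hS h hl (by omega) (Or.inr h2)) (by omega) hle' (by omega)
    · exact ih (M_par_hi hD hS h hl (by omega)) (by omega) hle' (by omega)

theorem forced (hS : IsStr (unGT T D K hD) b m S)
    {q u : T.N} {W : Set T.N} (h : Mem S q W (some u)) (hle : T.Le q u)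
    (hq : K + 2 ≤ T.len q) (hl : T.len u ≤ m) : Mem S u W (some u) := by
  obtain ⟨d, hd⟩ : ∃ d, T.len u = T.len q + d := ⟨T.len u - T.len q, by have := le_len hle; omega⟩
  induction d generalizing q with
  | zero =>
    have := le_antisymm_len hle (by omega)
    subst this; exact h
  | succ d ih =>
    obtain ⟨v, hv, hvl⟩ := exists_anc u (T.len q + 1) (by omega)
    have hqv : T.par v = q := by
      rcases le_cases (le_total hle hv (by omega)) with e | e
      · rw [e] at hvl; omega
      · exact (le_antisymm_len e (by rw [T.len_par]; omega)).symm
    have hc : T.Child q v := ⟨hqv, hvl⟩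
    refine ih (q := v) ?_ hv (by omega) (by omega)
    have hu := h.1.2.2 hq
    by_cases ht : turn b (T.len q)
    · obtain ⟨r, W', o', h1, h2, h3, h4, -⟩ := M_mine hD hS h (by omega) ht
      have h1l := h1.2
      rw [if_neg (by omega)] at h3 h4
      subst h3 h4
      have h5 := h2.1.2.2 (by omega)
      have : r = v := by
        rcases h5.2.2 with e | e
        · have := le_len e
          have e2 := le_antisymm_len e (by omega)
          rw [← e2]
          exact (le_antisymm_len hv (by rw [e2]; omega)).symm
        · exact le_antisymm_len (le_total e hv (by omega)) (by omega)
      rwa [← this]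
    · refine M_opp hD hS h (by omega) ht hc ⟨fun _ => by omega, fun _ => by omega, fun _ => ?_⟩
        (by rw [if_neg (by omega)]) (by rw [if_neg (by omega)])
      exact ⟨hu.1, hu.2.1, Or.inr hv⟩

end lemmas

def W0 (S : Set (UN T D K)) : Set T.N :=
  {u | EN T D K u ∧ ¬ ∃ W q, T.len q = K + 2 ∧ Mem S q W (some u)}

def AW (b : Bool) (S : Set (UN T D K)) (W : Set T.N) : Prop := b = false → W = W0 S

noncomputable def Wc (S : Set (UN T D K)) (u : T.N) : Set T.N :=
  Classical.epsilon (fun W => ∃ q, T.len q = K + 2 ∧ Mem S q W (some u))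

def BW (b : Bool) (S : Set (UN T D K)) (u : T.N) (W : Set T.N) : Prop := b = false → W = Wc S u

def Stay (b : Bool) (S : Set (UN T D K)) (q : T.N) : Prop :=
  ∃ W, AW b S W ∧ Mem S q W none ∧ (q ∈ D → ¬ (q ∈ W ↔ b = true))

def Go (b : Bool) (S : Set (UN T D K)) (q : T.N) : Prop :=
  ∃ u W W1, EN T D K u ∧ T.Le u q ∧ AW b S W ∧ Mem S (T.par u) W none ∧
    (¬ turn b (T.len u) → Mem S u W none) ∧ BW b S u W1 ∧ Mem S q W1 (some u)

def Phi (b : Bool) (S : Set (UN T D K)) : Set T.N :=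
  {q | (T.len q ≤ K + 1 ∧ ∃ W, Mem S q W none) ∨ (K + 2 ≤ T.len q ∧ (Stay b S q ∨ Go b S q))}

theorem turn_succ (b : Bool) (n : ℕ) : turn b (n+1) ↔ ¬ turn b n := by
  unfold turn; rw [Nat.even_add_one]; tauto


section lemmas2

theorem H1 (hK : Even K) (hS : IsStr (unGT T D K hD) b m S)
    {q : T.N} {W W' : Set T.N} {o o' : Option T.N} (h : Mem S q W o) (hA : AW b S W)
    (h' : Mem S q W' o') (hA' : AW b S W') (hq : K + 1 ≤ T.len q) (hl : T.len q ≤ m) : W = W' := by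
  cases b with
  | false => rw [hA rfl, hA' rfl]
  | true =>
    obtain ⟨q0, h0, h0l⟩ := exists_anc q (K+1) hq
    have a := M_down hD hS h hl h0l h0
    have a' := M_down hD hS h' hl h0l h0
    have hp := M_par hD hS a (by omega)
    rw [if_pos (by omega), if_pos (by omega)] at hp
    have hlp := T.len_par q0
    obtain ⟨r, W2, o2, h1, h2, h3, h4, h5⟩ := M_mine hD hS hp (by omega) (by
      unfold turn; rw [hlp, h0l]; simpa using hK)
    have e := h5 q0 W none (child_par (by omega)) a (by rw [if_pos (by omega)])
      (by rw [if_pos (by omega)])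
    have e' := h5 q0 W' none (child_par (by omega)) a' (by rw [if_pos (by omega)])
      (by rw [if_pos (by omega)])
    rw [e.2.1, e'.2.1]

theorem H2 (hK : Even K) (hS : IsStr (unGT T D K hD) b m S)
    {q q' u : T.N} {W W' : Set T.N} (h : Mem S q W (some u)) (hA : BW b S u W)
    (h' : Mem S q' W' (some u)) (hA' : BW b S u W') (hc : T.Child q q')
    (hq : K + 2 ≤ T.len q) (hl : T.len q' ≤ m) : W = W' := by
  cases b with
  | false => rw [hA rfl, hA' rfl]
  | true =>
    have := hc.2
    have h2 := M_par_hi hD hS h' hl (by omega)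
    rw [hc.1] at h2
    exact H1 hD hK hS h (by rintro ⟨⟩) h2 (by rintro ⟨⟩) (by omega) (by omega)

theorem H3 (hK : Even K) (hS : IsStr (unGT T D K hD) b m S)
    {u : T.N} {W : Set T.N} (hu : EN T D K u) (hl : T.len u ≤ m) (hA : AW b S W)
    (h : Mem S (T.par u) W none) (hW : u ∈ W ↔ b = true) :
    ∃ W1, BW b S u W1 ∧ Mem S u W1 (some u) := by
  have hu1 := hu.1
  have hlp := T.len_par u
  cases b with
  | true =>
    refine ⟨W, by rintro ⟨⟩, ?_⟩
    obtain ⟨v, hv, hvl⟩ := exists_anc u (K+2) hu.1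
    have hlv := T.len_par v
    have a := M_down hD hS (q0 := T.par v) h (by omega) (by omega) (by
      rcases le_cases hv with e | e
      · rw [e]; exact le_refl _
      · exact par_le e)
    have a2 : Mem S v W (some u) := M_opp hD hS a (by omega) (by
      unfold turn; rw [hlv, hvl]; simpa [Nat.even_add_one] using hK) (child_par (by omega))
      ⟨fun _ => by omega, fun _ => by omega, fun _ => ⟨hW.2 rfl, hu, Or.inr hv⟩⟩
      (by rw [if_neg (by omega)]) (by rw [if_pos (by omega)])
    exact forced hD hS a2 hv (by omega) hl
  | false =>
    refine ⟨Wc S u, fun _ => rfl, ?_⟩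
    have hn : u ∉ W := fun e => by simpa using hW.1 e
    rw [hA rfl] at hn
    have hex : ∃ W q, T.len q = K + 2 ∧ Mem S q W (some u) := by
      by_contra hne; exact hn ⟨hu, hne⟩
    obtain ⟨q, hq, hm⟩ := Classical.epsilon_spec hex
    refine forced hD hS hm ?_ (by omega) hl
    rcases (hm.1.2.2 (by omega)).2.2 with e | e
    · rw [le_antisymm_len e (by have := le_len e; omega)]; exact le_refl _
    · exact e

theorem H4 (hK : Even K) (hS : IsStr (unGT T D K hD) b m S)
    {q : T.N} {W : Set T.N} (hq : T.len q = K + 1) (hl : T.len q ≤ m)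
    (h : Mem S q W none) : ∃ W', AW b S W' ∧ Mem S q W' none := by
  cases b with
  | true => exact ⟨W, by rintro ⟨⟩, h⟩
  | false =>
    refine ⟨W0 S, fun _ => rfl, ?_⟩
    have hp := M_par hD hS h hl
    rw [if_pos (by omega), if_pos (by omega)] at hp
    have hlp := T.len_par q
    exact M_opp hD hS hp (by omega) (by unfold turn; rw [hlp, hq]; simpa using hK)
      (child_par (by omega)) ⟨fun _ => by omega, fun _ => rfl, fun _ => by omega⟩
      (by rw [if_pos (by omega)]) (by rw [if_pos (by omega)])

theorem stayD (hK : Even K) (hS : IsStr (unGT T D K hD) b m S)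
    {q : T.N} {W : Set T.N} (hq : K + 2 ≤ T.len q) (hl : T.len q < m)
    (h : Mem S q W none) (hd : q ∈ D) (hn : ¬ (q ∈ W ↔ b = true)) : False := by
  have hL := h.1.2.2 hq
  have h2 := hL.2 hd
  by_cases ht : turn b (T.len q)
  · obtain ⟨r, W', o', h1, h2, h3, h4, -⟩ := M_mine hD hS h hl ht
    have := h1.2
    rw [if_neg (by omega)] at h4
    subst h4
    have h5 := (h2.1.2.2 (by omega)).1
    rw [h1.1] at h5
    rcases h5 with e | e
    · omega
    · exact e hd
  · apply hn
    unfold turn at ht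
    rw [← Nat.not_even_iff_odd] at h2
    tauto

theorem go_D {q : T.N} (hD : ∀ q, T.par q ∈ D → q ∈ D) (h : Go b S q) : q ∈ D := by
  obtain ⟨u, W, W1, h1, h2, -⟩ := h
  exact D_mono hD h2 h1.2.1

theorem Phi_str (hK : Even K) (hS : IsStr (unGT T D K hD) b m S)
    : IsStr T b m (Phi b S) where
  root := Or.inl ⟨by rw [T.len_root]; omega, ∅, _, hS.root⟩
  par := by
    intro q hq hl
    have hlp := T.len_par q
    rcases hq with ⟨h1, W, h2⟩ | ⟨h1, h2⟩
    · left
      have := M_par hD hS h2 hl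
      rw [if_pos (by omega), if_pos (by omega)] at this
      exact ⟨by omega, _, this⟩
    by_cases h3 : T.len q = K + 2
    · left
      refine ⟨by omega, ?_⟩
      rcases h2 with ⟨W, -, h, -⟩ | ⟨u, W, W1, -, -, -, -, -, -, h⟩
      · exact ⟨_, M_par_mid hD hS h hl h1 (Or.inr h3)⟩
      · exact ⟨_, M_par_mid hD hS h hl h1 (Or.inr h3)⟩
    · right
      refine ⟨by omega, ?_⟩
      rcases h2 with ⟨W, hA, h, hw⟩ | ⟨u, W, W1, h4, h5, h6, h7, h8, h9, h10⟩
      · left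
        refine ⟨W, hA, M_par_hi hD hS h hl (by omega), fun h5 => ?_⟩
        rcases (h.1.2.2 h1).1 with e | e
        · omega
        · exact absurd h5 e
      · rcases le_cases h5 with e | e
        · left
          subst e
          refine ⟨W, h6, h7, fun h11 => ?_⟩
          rcases h4.2.2 with e | e
          · omega
          · exact absurd h11 e
        · right
          exact ⟨u, W, W1, h4, e, h6, h7, h8, h9, M_par_hi hD hS h10 hl (by omega)⟩
  mine := by
    intro q hq hl ht
    -- the common step
    have common : ∀ W, AW b S W → Mem S q W none → (T.len q = K + 1 ∨ K + 2 ≤ T.len q ∧ q ∉ D) →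
        ∃ r, T.Child q r ∧ r ∈ Phi b S ∧ ∀ r', T.Child q r' → r' ∈ Phi b S → r' = r := by
      intro W hA h hc
      obtain ⟨r, W', o', h1, h2, h3, h4, h5⟩ := M_mine hD hS h hl ht
      have h1l := h1.2
      rw [if_neg (by omega)] at h3
      subst h3
      have ho : o' = none := by
        rcases hc with hc | hc
        · have hb : b = false := by
            unfold turn at ht
            rw [hc] at ht
            by_contra hb
            have : b = true := by simpa using hb
            have := ht.2 this
            rw [Nat.even_add_one] at this
            exact this hK
          cases o' with
          | none => rfl
          | some u =>
            exfalso
            have h6 := (h2.1.2.2 (by omega)).1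
            rw [hA hb] at h6
            exact h6.2 ⟨W, r, by omega, h2⟩
        · rw [if_neg (by omega)] at h4; exact h4.symm
      subst ho
      have huniq : ∀ r', T.Child q r' → Mem S r' W none → r' = r := by
        intro r' hr' hm
        have := hr'.2
        exact (h5 r' W none hr' hm (by rw [if_neg (by omega)]) (by simp)).1
      have hrq : T.len r = K + 2 ∨ T.par r ∉ D := by
        rcases hc with hc | hc
        · left; omega
        · right; rw [h1.1]; exact hc.2
      refine ⟨r, h1, Or.inr ⟨by omega, ?_⟩, ?_⟩
      · by_cases hr : r ∈ D
        · right
          have hE : EN T D K r := ⟨by omega, hr, hrq⟩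
          have h6 := (h2.1.2.2 (by omega)).2 hr
          have hp : Mem S (T.par r) W none := by rw [h1.1]; exact h
          obtain ⟨W1, hB, hM⟩ := H3 hD hK hS hE (by omega) hA hp (by
            rw [← h6, h1l, Nat.odd_add_one, Nat.not_odd_iff_even]; exact ht)
          exact ⟨r, W, W1, hE, le_refl _, hA, hp, fun _ => h2, hB, hM⟩
        · left; exact ⟨W, hA, h2, fun h => absurd h hr⟩
      · intro r' hr' hr'P
        have hr'l := hr'.2
        rcases hr'P with ⟨h6, -⟩ | ⟨-, ⟨W', hA', hM', -⟩ | ⟨u, W', W1, h6, h7, h8, h9, h10, -, -⟩⟩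
        · omega
        · have h7 := M_par_mid hD hS hM' (by omega) (by omega) (Or.inl rfl)
          rw [hr'.1] at h7
          have := H1 hD hK hS h7 hA' h hA (by omega) (by omega)
          subst this
          exact huniq r' hr' hM'
        · have hur : u = r' := by
            rcases le_cases h7 with e | e
            · exact e
            · rw [hr'.1] at e
              rcases hc with hc | hc
              · have := le_len e; have := h6.1; omega
              · exact absurd (D_mono hD e h6.2.1) hc.2
          subst hur
          rw [hr'.1] at h9
          have := H1 hD hK hS h9 h8 h hA (by omega) (by omega)
          subst this
          apply huniq u hr' (h10 _)
          rw [hr'l, turn_succ]; simpa using ht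
    rcases hq with ⟨h1, W, h2⟩ | ⟨h1, h2⟩
    · by_cases h3 : T.len q = K + 1
      · obtain ⟨W', hA, h4⟩ := H4 hD hK hS h3 (by omega) h2
        exact common W' hA h4 (Or.inl h3)
      · obtain ⟨r, W', o', h4, h5, h6, h7, h8⟩ := M_mine hD hS h2 hl ht
        have h4l := h4.2
        have := h5.1.2.1 (by omega)
        subst this
        refine ⟨r, h4, Or.inl ⟨by omega, _, h5⟩, fun r' hr' hP => ?_⟩
        have hr'l := hr'.2
        rcases hP with ⟨-, W'', h9⟩ | ⟨h9, -⟩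
        · exact (h8 r' W'' none hr' h9 (by rw [if_pos (by omega)]; exact h2.1.1 (by omega))
            (by simp)).1
        · omega
    · rcases h2 with ⟨W, hA, h, hw⟩ | ⟨u, W, W1, h4, h5, h6, h7, h8, h9, h10⟩
      · by_cases hd : q ∈ D
        · exact (stayD hD hK hS h1 hl h hd (hw hd)).elim
        · exact common W hA h (Or.inr ⟨h1, hd⟩)
      · obtain ⟨r, W', o', g1, g2, g3, g4, g5⟩ := M_mine hD hS h10 hl ht
        have g1l := g1.2
        rw [if_neg (by omega)] at g3 g4
        subst g3 g4
        have hur : T.Le u r := le_of_par (by rw [g1.1]; exact h5)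
        refine ⟨r, g1, Or.inr ⟨by omega, Or.inr ⟨u, W, W1, h4, hur, h6, h7, h8, h9, g2⟩⟩, ?_⟩
        intro r' hr' hP
        have hr'l := hr'.2
        rcases hP with ⟨e, -⟩ | ⟨-, ⟨W', hA', hM', -⟩ | ⟨u', W', W1', k1, k2, -, -, -, k6, k7⟩⟩
        · omega
        · exfalso
          rcases (hM'.1.2.2 (by omega)).1 with e | e
          · omega
          · rw [hr'.1] at e; exact e (D_mono hD h5 h4.2.1)
        · have := EN_uniq hD h4 k1 (le_of_par (by rw [hr'.1]; exact h5)) k2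
          subst this
          have := H2 hD hK hS h10 h9 k7 k6 hr' h1 (by omega)
          subst this
          exact (g5 r' W1 (some u) hr' k7 (by rw [if_neg (by omega)])
            (by rw [if_neg (by omega)])).1
  opp := by
    intro q hq hl ht r hr
    have hrl := hr.2
    have common : ∀ W, AW b S W → Mem S q W none → (T.len q = K + 1 ∨ K + 2 ≤ T.len q ∧ q ∉ D) →
        r ∈ Phi b S := by
      intro W hA h hc
      have hrq : T.len r = K + 2 ∨ T.par r ∉ D := by
        rcases hc with hc | hc
        · left; omega
        · right; rw [hr.1]; exact hc.2
      refine Or.inr ⟨by omega, ?_⟩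
      by_cases hrD : r ∈ D ∧ (r ∈ W ↔ b = true)
      · right
        have hE : EN T D K r := ⟨by omega, hrD.1, hrq⟩
        have hp : Mem S (T.par r) W none := by rw [hr.1]; exact h
        obtain ⟨W1, hB, hM⟩ := H3 hD hK hS hE (by omega) hA hp hrD.2
        refine ⟨r, W, W1, hE, le_refl _, hA, hp, fun h => ?_, hB, hM⟩
        rw [hrl, turn_succ] at h
        exact absurd ht h
      · left
        have hn : r ∈ D → ¬ (r ∈ W ↔ b = true) := fun h1 h2 => hrD ⟨h1, h2⟩
        refine ⟨W, hA, M_opp hD hS h hl ht hr ⟨fun _ => by omega, fun _ => rfl, fun _ =>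
          ⟨hrq, fun h1 => ?_⟩⟩ (by rw [if_neg (by omega)]) (by simp), hn⟩
        have := hn h1
        rw [hrl, Nat.odd_add_one, Nat.not_odd_iff_even]
        unfold turn at ht
        tauto
    rcases hq with ⟨h1, W, h2⟩ | ⟨h1, h2⟩
    · by_cases h3 : T.len q = K + 1
      · obtain ⟨W', hA, h4⟩ := H4 hD hK hS h3 (by omega) h2
        exact common W' hA h4 (Or.inl h3)
      · have := h2.1.1 (by omega)
        subst this
        exact Or.inl ⟨by omega, ∅, M_opp hD hS h2 hl ht hr
          ⟨fun _ => rfl, fun _ => rfl, fun _ => by omega⟩ (by simp) (by simp)⟩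
    · rcases h2 with ⟨W, hA, h, hw⟩ | ⟨u, W, W1, h4, h5, h6, h7, h8, h9, h10⟩
      · by_cases hd : q ∈ D
        · exact (stayD hD hK hS h1 hl h hd (hw hd)).elim
        · exact common W hA h (Or.inr ⟨h1, hd⟩)
      · have hur : T.Le u r := le_of_par (by rw [hr.1]; exact h5)
        have hL := h10.1.2.2 h1
        refine Or.inr ⟨by omega, Or.inr ⟨u, W, W1, h4, hur, h6, h7, h8, h9, ?_⟩⟩
        exact M_opp hD hS h10 hl ht hr ⟨fun _ => by omega, fun _ => by omega, fun _ =>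
          ⟨hL.1, h4, Or.inl hur⟩⟩ (by rw [if_neg (by omega)]) (by rw [if_neg (by omega)])

end lemmas2

theorem Phi_loc (b : Bool) (m : ℕ) (S S' : Set (UN T D K))
    (e : ∀ z : UN T D K, T.len z.q ≤ m → (z ∈ S ↔ z ∈ S')) (q : T.N) (hq : T.len q ≤ m)
    (h : q ∈ Phi b S) : q ∈ Phi b S' := by
  have eM : ∀ {q W o}, T.len q ≤ m → (Mem S q W o ↔ Mem S' q W o) := by
    intro q W o hq
    constructor
    · rintro ⟨h, h'⟩; exact ⟨h, (e _ hq).1 h'⟩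
    · rintro ⟨h, h'⟩; exact ⟨h, (e _ hq).2 h'⟩
  rcases h with ⟨h1, W, h2⟩ | ⟨h1, h2⟩
  · exact Or.inl ⟨h1, W, (eM hq).1 h2⟩
  · have eP : ∀ u W, (∃ q, T.len q = K + 2 ∧ Mem S q W (some u)) ↔
        (∃ q, T.len q = K + 2 ∧ Mem S' q W (some u)) := by
      intro u W
      apply exists_congr; intro q
      apply and_congr_right; intro hq
      exact eM (by omega)
    have eW : W0 S = W0 S' := by
      ext u
      simp only [W0, Set.mem_setOf_eq, eP]
    have eA : ∀ W, AW b S W ↔ AW b S' W := by intro W; unfold AW; rw [eW]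
    have eC : ∀ u, Wc S u = Wc S' u := by
      intro u; unfold Wc; congr 1; funext W; exact propext (eP u W)
    have eB : ∀ u W, BW b S u W ↔ BW b S' u W := by intro u W; unfold BW; rw [eC]
    refine Or.inr ⟨h1, ?_⟩
    rcases h2 with ⟨W, hA, h, hw⟩ | ⟨u, W, W1, h4, h5, h6, h7, h8, h9, h10⟩
    · exact Or.inl ⟨W, (eA W).1 hA, (eM hq).1 h, hw⟩
    · have := le_len h5
      exact Or.inr ⟨u, W, W1, h4, h5, (eA W).1 h6, (eM (by rw [T.len_par]; omega)).1 h7,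
        fun h => (eM (by omega)).1 (h8 h), (eB u W1).1 h9, (eM hq).1 h10⟩

open Classical in
theorem Phi_lift (hK : Even K)
    (hS : ∀ m, IsStr (unGT T D K hD) b m S) (x : ℕ → T.N) (hx : T.IsPlay x)
    (hxs : ∀ n, x n ∈ Phi b S) :
    ∃ y, (unGT T D K hD).IsPlay y ∧ (∀ n, y n ∈ S) ∧ ∀ n, (y n : UN T D K).q = x n := by
  have hxl := hx.1
  have main : ∃ W o n0, K + 2 ≤ n0 ∧ ∀ n, n0 ≤ n → Mem S (x n) W o := by
    by_cases hd : ∃ j, K + 2 ≤ j ∧ x j ∈ D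
    · obtain ⟨j, hj, hjD⟩ := hd
      have hgo : ∀ n, j ≤ n → Go b S (x n) := by
        intro n hn
        have hnD : x n ∈ D := D_mono hD (hx.le hn) hjD
        rcases hxs n with ⟨h1, -⟩ | ⟨h1, ⟨W, hA, h, hw⟩ | h2⟩
        · rw [hxl] at h1; omega
        · exact (stayD hD hK (hS _) h1 (Nat.lt_succ_self _) h hnD (hw hnD)).elim
        · exact h2
      obtain ⟨u, W, W1, h4, h5, -, -, -, h9, h10⟩ := hgo j le_rfl
      refine ⟨W1, some u, j, hj, fun n hn => ?_⟩
      have : BW b S u W1 ∧ Mem S (x n) W1 (some u) := by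
        refine ⟨h9, ?_⟩
        induction n, hn using Nat.le_induction with
        | base => exact h10
        | succ n hn ih =>
          obtain ⟨u', W', W1', k4, k5, -, -, -, k9, k10⟩ := hgo (n+1) (by omega)
          have := EN_uniq hD k4 h4 k5 (le_trans h5 (hx.le (by omega)))
          subst this
          rw [H2 hD hK (hS (n+1)) ih h9 k10 k9 (hx.child n) (by rw [hxl]; omega) (by rw [hxl])]
          exact k10
      exact this.2
    · push Not at hd
      have hst : ∀ n, K + 2 ≤ n → Stay b S (x n) := by
        intro n hn
        rcases hxs n with ⟨h1, -⟩ | ⟨h1, h2 | h2⟩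
        · rw [hxl] at h1; omega
        · exact h2
        · exact absurd (go_D hD h2) (hd n hn)
      obtain ⟨W, hA, h, -⟩ := hst (K+2) le_rfl
      refine ⟨W, none, K+2, le_rfl, fun n hn => ?_⟩
      induction n, hn using Nat.le_induction with
      | base => exact h
      | succ n hn ih =>
        obtain ⟨W', hA', h', -⟩ := hst (n+1) (by omega)
        have h2 := M_par_hi hD (hS (n+1)) h' (by rw [hxl]) (by rw [hxl]; omega)
        rw [hx.2] at h2
        rw [H1 hD hK (hS n) ih hA h2 hA' (by rw [hxl]; omega) (by rw [hxl])]
        exact h'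
  obtain ⟨W, o, n0, hn0, hM⟩ := main
  have hall : ∀ n, Mem S (x n) (if n ≤ K then ∅ else W) (if n ≤ K + 1 then none else o) := by
    have hstep : ∀ n, Mem S (x (n+1)) (if n+1 ≤ K then ∅ else W)
        (if n+1 ≤ K + 1 then none else o) →
        Mem S (x n) (if n ≤ K then ∅ else W) (if n ≤ K + 1 then none else o) := by
      intro n hn
      have := M_par hD (hS (n+1)) hn (by rw [hxl])
      rw [hx.2, hxl] at this
      convert this using 1
      · split_ifs <;> first | rfl | omega
      · split_ifs <;> first | rfl | omega
    intro n
    by_cases hn : n0 ≤ n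
    · rw [if_neg (by omega), if_neg (by omega)]; exact hM n hn
    · have : ∀ d n, n + d = n0 →
          Mem S (x n) (if n ≤ K then ∅ else W) (if n ≤ K + 1 then none else o) := by
        intro d
        induction d with
        | zero =>
          intro n hn
          rw [if_neg (by omega), if_neg (by omega)]; exact hM n (by omega)
        | succ d ih => exact fun n hn => hstep n (ih (n+1) (by omega))
      exact this (n0 - n) n (by omega)
  refine ⟨fun n => ⟨x n, _, _, (hall n).1⟩, ⟨fun n => hxl n, fun n => ?_⟩,
    fun n => (hall n).2, fun n => rfl⟩
  simp only [unGT, UN.mk.injEq]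
  refine ⟨hx.2 n, ?_, ?_⟩
  · rw [hxl]; split_ifs <;> first | rfl | omega
  · rw [hxl]; split_ifs <;> first | rfl | omega

def unCover (hK : Even K) (k : ℕ) (hk : k ≤ K) : Cover (unGT T D K hD) T k where
  f z := z.q
  len _ := rfl
  par _ := rfl
  inj := by
    rintro ⟨q, W, o, h⟩ ⟨q', W', o', h'⟩ hl e
    have hl' : T.len q ≤ k := hl
    have e' : q = q' := e
    subst e'
    have h1 := h.1 (by omega)
    have h2 := h.2.1 (by omega)
    have h3 := h'.1 (by omega)
    have h4 := h'.2.1 (by omega)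
    subst h1 h2 h3 h4
    rfl
  surj q hl := ⟨⟨q, ∅, none, fun _ => rfl, fun _ => rfl, fun _ => by omega⟩, rfl⟩
  φ b S := Phi b S
  loc b m S S' e q hq := ⟨Phi_loc b m S S' e q hq, Phi_loc b m S' S (fun z hz => (e z hz).symm) q hq⟩
  str b m S hS := Phi_str hD hK hS
  lift b S hS x hx hxs := Phi_lift hD hK hS x hx hxs
  low := by
    rintro b S ⟨q, W, o, h⟩ hl
    have hl' : T.len q ≤ k := hl
    have h1 := h.1 (by omega)
    have h2 := h.2.1 (by omega)
    subst h1 h2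
    constructor
    · rintro (⟨-, W, h3, h4⟩ | ⟨h3, -⟩)
      · have := h3.1 (show T.len q ≤ K by omega)
        subst this
        exact h4
      · have h3' : K + 2 ≤ T.len q := h3
        omega
    · intro hm
      refine Or.inl ⟨?_, ∅, h, hm⟩
      show T.len q ≤ _
      omega

end Unravel

def Clopen (T : GT.{u}) (B : Set (ℕ → T.N)) : Prop :=
  ∀ y, T.IsPlay y → ∃ n, ∀ y', T.IsPlay y' → y' n = y n → (y ∈ B ↔ y' ∈ B)

def OpenP (T : GT.{u}) (B : Set (ℕ → T.N)) : Prop :=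
  ∀ y, T.IsPlay y → y ∈ B → ∃ n, ∀ y', T.IsPlay y' → y' n = y n → y' ∈ B

theorem unravel_open (T : GT.{u}) (B : Set (ℕ → T.N)) (hB : OpenP T B) (k : ℕ) :
    ∃ (T' : GT.{u}) (C : Cover T' T k), Clopen T' {y | (fun n => C.f (y n)) ∈ B} := by
  let D : Set T.N := {q | ∀ y, T.IsPlay y → y (T.len q) = q → y ∈ B}
  have hD : ∀ q, T.par q ∈ D → q ∈ D := by
    intro q hq y hy hyq
    apply hq y hy
    by_cases h0 : T.len q = 0
    · rw [T.eq_root q h0, T.par_root, T.len_root]; exact hy.zero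
    · rw [T.len_par, ← hyq, ← hy.2]
      rw [hy.1, Nat.sub_add_cancel (by omega)]
  have hDB : ∀ y, T.IsPlay y → (y ∈ B ↔ ∃ n, y n ∈ D) := by
    intro y hy
    constructor
    · intro h
      obtain ⟨n, hn⟩ := hB y hy h
      exact ⟨n, fun y' hy' e => hn y' hy' (by rwa [hy.1] at e)⟩
    · rintro ⟨n, hn⟩
      exact hn y hy (by rw [hy.1])
  have hK : Even (2 * k) := even_two_mul k
  refine ⟨unGT T D (2*k) hD, unCover hD hK k (by omega), ?_⟩
  intro y hy
  have hyo : ∀ y, (unGT T D (2*k) hD).IsPlay y → ∀ n, 2*k+2 ≤ n →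
      (y n : UN T D (2*k)).o = (y (2*k+2) : UN T D (2*k)).o := by
    intro y hy n hn
    induction n, hn using Nat.le_induction with
    | base => rfl
    | succ n hn ih =>
      rw [← ih, ← hy.2 n]
      have := hy.1 (n+1)
      simp only [unGT] at this ⊢
      rw [if_neg (by omega)]
  have hdec : ∀ y, (unGT T D (2*k) hD).IsPlay y →
      ((fun n => (y n : UN T D (2*k)).q) ∈ B ↔ (y (2*k+2) : UN T D (2*k)).o ≠ none) := by
    intro y hy
    have hxp : T.IsPlay (fun n => (y n : UN T D (2*k)).q) := (unCover hD hK k (by omega)).toHom.play hy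
    rw [hDB _ hxp]
    constructor
    · rintro ⟨n, hn⟩ hne
      have h1 : (y (n + (2*k+2)) : UN T D (2*k)).q ∈ D := D_mono hD (hxp.le (by omega)) hn
      have h2 := (y (n + (2*k+2) + 1) : UN T D (2*k)).h.2.2 (by rw [hxp.1]; omega)
      rw [hyo y hy _ (by omega), hne] at h2
      rcases h2.1 with e | e
      · rw [hxp.1] at e; omega
      · rw [hxp.2] at e; exact e h1
    · intro hne
      obtain ⟨u, hu⟩ := Option.ne_none_iff_exists'.1 hne
      have h2 := (y (T.len u + (2*k+2)) : UN T D (2*k)).h.2.2 (by rw [hxp.1]; omega)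
      rw [hyo y hy _ (by omega), hu] at h2
      rcases h2.2.2 with e | e
      · exact ⟨_, by rw [hxp.eq_of_le e]; exact h2.2.1.2.1⟩
      · have := le_len e
        rw [hxp.1] at this; omega
  refine ⟨2*k+2, fun y' hy' e => ?_⟩
  show (fun n => (y n : UN T D (2*k)).q) ∈ B ↔ (fun n => (y' n : UN T D (2*k)).q) ∈ B
  rw [hdec y hy, hdec y' hy', e]

end BD

namespace BD
open BD.GT

/-- `b` has a (multi-valued) winning strategy from `q`. -/
structure MS (T : GT.{u}) (b : Bool) (X : Set (ℕ → T.N)) (q : T.N) (S : Set T.N) : Prop where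
  mem : q ∈ S
  mine : ∀ r ∈ S, turn b (T.len r) → ∃ c, T.Child r c ∧ c ∈ S
  opp : ∀ r ∈ S, ¬ turn b (T.len r) → ∀ c, T.Child r c → c ∈ S
  win : ∀ x, T.IsPlay x → x (T.len q) = q → (∀ m, T.len q ≤ m → x m ∈ S) → x ∈ X

def Wn (T : GT.{u}) (b : Bool) (X : Set (ℕ → T.N)) (q : T.N) : Prop := ∃ S, MS T b X q S

theorem Wn_glue {T : GT.{u}} {b : Bool} {X : Set (ℕ → T.N)} {q : T.N} (R : Set T.N) (hq : q ∈ R)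
    (h1 : ∀ r ∈ R, turn b (T.len r) → ∃ c, T.Child r c ∧ (c ∈ R ∨ Wn T b X c))
    (h2 : ∀ r ∈ R, ¬ turn b (T.len r) → ∀ c, T.Child r c → (c ∈ R ∨ Wn T b X c))
    (h3 : ∀ x, T.IsPlay x → x (T.len q) = q → (∀ m, T.len q ≤ m → x m ∈ R) → x ∈ X) :
    Wn T b X q := by
  by_cases hW : Wn T b X q
  · exact hW
  have hex : ∀ c, ∃ S, Wn T b X c → MS T b X c S := fun c => by
    by_cases h : Wn T b X c
    · obtain ⟨S, hS⟩ := h; exact ⟨S, fun _ => hS⟩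
    · exact ⟨∅, fun h' => absurd h' h⟩
  choose σ hσ using hex
  let M1 : Set T.N := {r | T.Le q r ∧ ∀ u, T.Le q u → T.Le u r → u ∈ R ∧ ¬ Wn T b X u}
  let M2 : T.N → Set T.N := fun c => {r | Wn T b X c ∧ T.Child (T.par c) c ∧ T.par c ∈ M1 ∧
    T.Le c r ∧ r ∈ σ c}
  have step1 : ∀ r ∈ M1, ∀ c, T.Child r c → (c ∈ R ∨ Wn T b X c) → c ∈ M1 ∨ ∃ c', c ∈ M2 c' := by
    intro r hr c hc h
    by_cases hw : Wn T b X c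
    · right
      refine ⟨c, hw, ⟨rfl, by rw [hc.1, hc.2]⟩, by rw [hc.1]; exact hr, le_refl _, (hσ c hw).mem⟩
    · left
      refine ⟨le_of_par (by rw [hc.1]; exact hr.1), fun u hu hu' => ?_⟩
      rcases le_cases hu' with rfl | h'
      · exact ⟨h.resolve_right hw, hw⟩
      · rw [hc.1] at h'; exact hr.2 u hu h'
  refine ⟨{r | r ∈ M1 ∨ ∃ c, r ∈ M2 c}, ?_, ?_, ?_, ?_⟩
  · left
    refine ⟨le_refl _, fun u hu hu' => ?_⟩
    have : u = q := le_antisymm_len hu' (Nat.le_antisymm (le_len hu') (le_len hu))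
    subst this
    exact ⟨hq, hW⟩
  · rintro r (hr | ⟨c, hr⟩) ht
    · obtain ⟨c, hc, h⟩ := h1 r (hr.2 r hr.1 (le_refl _)).1 ht
      exact ⟨c, hc, step1 r hr c hc h⟩
    · obtain ⟨d, hd, hd'⟩ := (hσ c hr.1).mine r hr.2.2.2.2 ht
      exact ⟨d, hd, Or.inr ⟨c, hr.1, hr.2.1, hr.2.2.1, le_of_par (by rw [hd.1]; exact hr.2.2.2.1), hd'⟩⟩
  · rintro r (hr | ⟨c, hr⟩) ht d hd
    · exact step1 r hr d hd (h2 r (hr.2 r hr.1 (le_refl _)).1 ht d hd)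
    · have hd' := (hσ c hr.1).opp r hr.2.2.2.2 ht d hd
      exact Or.inr ⟨c, hr.1, hr.2.1, hr.2.2.1, le_of_par (by rw [hd.1]; exact hr.2.2.2.1), hd'⟩
  · intro x hx hxq hxS
    by_cases hall : ∀ m, T.len q ≤ m → x m ∈ M1
    · exact h3 x hx hxq fun m hm => ((hall m hm).2 _ (hall m hm).1 (le_refl _)).1
    · push Not at hall
      obtain ⟨m, hm, hm1⟩ := hall
      obtain ⟨c, hc⟩ := (hxS m hm).resolve_left hm1
      have hcx : x (T.len c) = c := hx.eq_of_le hc.2.2.2.1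
      have hqc : T.Le q c := le_of_par hc.2.2.1.1
      apply (hσ c hc.1).win x hx hcx
      intro j hj
      have hcj : T.Le c (x j) := by rw [← hcx]; exact hx.le hj
      have hqj : T.len q ≤ j := (le_len hqc).trans hj
      rcases hxS j hqj with h | ⟨c', hc'⟩
      · exact absurd hc.1 (h.2 c hqc hcj).2
      · have key : ∀ c c' : T.N, c ∈ M2 c → T.Child (T.par c') c' → T.par c' ∈ M1 → T.Le c (x j) →
            T.Le c' (x j) → T.len c' ≤ T.len c := by
          intro c c' h1 h2 h3 h4 h5
          by_contra hlt
          have := le_total h4 (par_le h5) (by rw [h2.2] at hlt; omega)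
          exact (h3.2 c (le_of_par h1.2.2.1.1) this).2 h1.1
        have e : T.len c = T.len c' := Nat.le_antisymm
          (key c' c ⟨hc'.1, hc'.2.1, hc'.2.2.1, le_refl _, (hσ c' hc'.1).mem⟩ hc.2.1 hc.2.2.1 hc'.2.2.2.1 hcj)
          (key c c' ⟨hc.1, hc.2.1, hc.2.2.1, le_refl _, (hσ c hc.1).mem⟩ hc'.2.1 hc'.2.2.1 hcj hc'.2.2.2.1)
        have e' : c = c' := le_antisymm_len (le_total hcj hc'.2.2.2.1 e.le) e
        subst e'
        exact hc'.2.2.2.2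

inductive Thin (T : GT.{u}) (b : Bool) (h : T.N → T.N) : T.N → Prop
  | root : Thin T b h T.root
  | mine (q) : Thin T b h q → turn b (T.len q) → T.Child q (h q) → Thin T b h (h q)
  | opp (q r) : Thin T b h q → ¬ turn b (T.len q) → T.Child q r → Thin T b h r

theorem Wn_str {T : GT.{u}} {b : Bool} {X : Set (ℕ → T.N)} (hW : Wn T b X T.root) :
    ∃ S, (∀ m, IsStr T b m S) ∧ ∀ x, T.IsPlay x → (∀ n, x n ∈ S) → x ∈ X := by
  obtain ⟨S, hS⟩ := hW
  have hex : ∀ q, ∃ c, q ∈ S → turn b (T.len q) → T.Child q c ∧ c ∈ S := fun q => by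
    by_cases h : q ∈ S ∧ turn b (T.len q)
    · obtain ⟨c, hc⟩ := hS.mine q h.1 h.2; exact ⟨c, fun _ _ => hc⟩
    · exact ⟨q, fun h1 h2 => absurd ⟨h1, h2⟩ h⟩
  choose h hh using hex
  have hTS : ∀ q, Thin T b h q → q ∈ S := by
    intro q hq
    induction hq with
    | root => exact hS.mem
    | mine q _ ht _ ih => exact (hh q ih ht).2
    | opp q r _ ht hc ih => exact hS.opp q ih ht r hc
  refine ⟨{q | Thin T b h q}, fun m => ⟨Thin.root, ?_, ?_, ?_⟩, ?_⟩
  · intro q hq _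
    cases hq with
    | root => rw [T.par_root]; exact Thin.root
    | mine q h1 _ h2 => rw [h2.1]; exact h1
    | opp q r h1 _ h2 => rw [h2.1]; exact h1
  · intro q hq _ ht
    have hc := (hh q (hTS q hq) ht).1
    refine ⟨h q, hc, Thin.mine q hq ht hc, fun r' hr' hr => ?_⟩
    cases hr with
    | root => have := hr'.2; rw [T.len_root] at this; omega
    | mine q' h1 _ h2 => rw [← hr'.1, h2.1]
    | opp q' r h1 h3 h2 => 
      have : q = q' := by rw [← hr'.1, h2.1]
      subst this
      exact absurd ht h3
  · intro q hq _ ht r hr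
    exact Thin.opp q r hq ht hr
  · intro x hx hxS
    exact hS.win x hx (by rw [T.len_root]; exact hx.zero) fun m _ => hTS _ (hxS m)

theorem clopen_det (T : GT.{u}) (B : Set (ℕ → T.N)) (hB : Clopen T B) :
    (∃ S, (∀ m, IsStr T true m S) ∧ ∀ x, T.IsPlay x → (∀ n, x n ∈ S) → x ∈ B) ∨
    (∃ S, (∀ m, IsStr T false m S) ∧ ∀ x, T.IsPlay x → (∀ n, x n ∈ S) → x ∉ B) := by
  let win : Bool → Set (ℕ → T.N) := fun b => {x | x ∈ B ↔ b = true}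
  by_contra hcon
  have hroot : ∀ b, ¬ Wn T b (win b) T.root := by
    intro b hb
    obtain ⟨S, h1, h2⟩ := Wn_str hb
    apply hcon
    cases b
    · right; exact ⟨S, h1, fun x hx hxs hxB => by simpa using (h2 x hx hxs).1 hxB⟩
    · left; exact ⟨S, h1, fun x hx hxs => (h2 x hx hxs).2 rfl⟩
  let R : Set T.N := {q | ∀ b, ¬ Wn T b (win b) q}
  have single : ∀ (q : T.N) (b : Bool) x, T.IsPlay x → x (T.len q) = q →
      (∀ m, T.len q ≤ m → x m ∈ ({q} : Set T.N)) → x ∈ win b := by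
    intro q b x hx hxq h
    have h1 : x (T.len q + 1) = q := h (T.len q + 1) (by omega)
    have := hx.1 (T.len q + 1)
    rw [h1] at this; omega
  have noW : ∀ q ∈ R, ∀ b, turn b (T.len q) → ∀ c, T.Child q c → ¬ Wn T b (win b) c := by
    intro q hq b ht c hc hW
    apply hq b
    refine Wn_glue {q} rfl ?_ ?_ (single q b)
    · rintro r rfl _; exact ⟨c, hc, Or.inr hW⟩
    · rintro r rfl h; exact absurd ht h
  have hturn : ∀ n, ∃ b, turn b n := fun n => by
    by_cases h : Even n
    · exact ⟨true, by simp [turn, h]⟩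
    · exact ⟨false, by simp [turn, h]⟩
  have hbb : ∀ b b' : Bool, b' = b ∨ b' = !b := by decide
  have stepR : ∀ q ∈ R, ∃ c, T.Child q c ∧ c ∈ R := by
    intro q hq
    obtain ⟨b, hb⟩ := hturn (T.len q)
    by_contra hno
    push Not at hno
    apply hq (!b)
    refine Wn_glue {q} rfl ?_ ?_ (single q _)
    · rintro r rfl h; exact absurd hb ((turn_not _ _).1 h)
    · rintro r rfl _ c hc
      right
      by_contra hn
      apply hno c hc
      intro b'
      rcases hbb b b' with rfl | rfl
      · exact noW r hq b' hb c hc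
      · exact hn
  have hex : ∀ q : R, ∃ c : R, T.Child q.1 c.1 := fun q => by
    obtain ⟨c, hc, hc'⟩ := stepR q.1 q.2; exact ⟨⟨c, hc'⟩, hc⟩
  choose nx hnx using hex
  let x : ℕ → R := fun n => nx^[n] ⟨T.root, hroot⟩
  have hxs : ∀ n, T.Child (x n).1 (x (n+1)).1 := fun n => by
    show T.Child _ (nx^[n+1] _).1
    rw [Function.iterate_succ_apply']; exact hnx _
  have hx : T.IsPlay (fun n => (x n).1) := by
    refine ⟨fun n => ?_, fun n => (hxs n).1⟩
    induction n with
    | zero => exact T.len_root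
    | succ n ih => have := (hxs n).2; simp only at ih; rw [ih] at this; exact this
  obtain ⟨n, hn⟩ := hB _ hx
  obtain ⟨b, hb⟩ : ∃ b, (fun n => (x n).1) ∈ win b := by
    by_cases h : (fun n => (x n).1) ∈ B
    · exact ⟨true, by simp [win, h]⟩
    · exact ⟨false, by simp [win, h]⟩
  apply (x n).2 b
  refine Wn_glue R (x n).2 ?_ ?_ ?_
  · intro r hr _
    obtain ⟨c, hc, hc'⟩ := stepR r hr
    exact ⟨c, hc, Or.inl hc'⟩
  · intro r hr ht c hc
    by_cases hw : Wn T b (win b) c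
    · exact Or.inr hw
    · left
      intro b'
      rcases hbb b b' with rfl | rfl
      · exact hw
      · exact noW r hr _ ((turn_not _ _).2 ht) c hc
  · intro y hy hyn _
    have hl : T.len (x n).1 = n := hx.1 n
    rw [hl] at hyn
    have := hn y hy hyn
    show y ∈ B ↔ _
    rw [← this]; exact hb

/-- `A` is unraveled after pulling back to any tree. -/
def UR (T0 : GT.{u}) (A : Set (ℕ → T0.N)) : Prop :=
  ∀ (T' : GT.{u}) (f : Hom T' T0) (k : ℕ), ∃ (T'' : GT.{u}) (C : Cover T'' T' k),
    Clopen T'' {y | (fun n => f.f (C.f (y n))) ∈ A}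

theorem UR.open {T0 : GT.{u}} {A : Set (ℕ → T0.N)} (h : OpenP T0 A) : UR T0 A := by
  intro T' f k
  have : OpenP T' {y | (fun n => f.f (y n)) ∈ A} := by
    intro y hy hyA
    obtain ⟨n, hn⟩ := h _ (f.play hy) hyA
    exact ⟨n, fun z hz e => hn _ (f.play hz) (by simp only [e])⟩
  exact unravel_open T' _ this k

theorem UR.compl {T0 : GT.{u}} {A : Set (ℕ → T0.N)} (h : UR T0 A) : UR T0 Aᶜ := by
  intro T' f k
  obtain ⟨T'', C, hC⟩ := h T' f k
  refine ⟨T'', C, fun y hy => ?_⟩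
  obtain ⟨n, hn⟩ := hC y hy
  exact ⟨n, fun z hz e => not_congr (hn z hz e)⟩

theorem UR.det {T : GT.{u}} {B : Set (ℕ → T.N)} (h : UR T B) :
    (∃ S, (∀ m, IsStr T true m S) ∧ ∀ x, T.IsPlay x → (∀ n, x n ∈ S) → x ∈ B) ∨
    (∃ S, (∀ m, IsStr T false m S) ∧ ∀ x, T.IsPlay x → (∀ n, x n ∈ S) → x ∉ B) := by
  obtain ⟨T', C, hC⟩ := h T (Hom.id T) 0
  rcases clopen_det T' _ hC with ⟨S, h1, h2⟩ | ⟨S, h1, h2⟩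
  · left
    refine ⟨C.φ true S, fun m => C.str _ _ _ (h1 m), fun x hx hxs => ?_⟩
    obtain ⟨y, hy, hys, e⟩ := C.lift _ _ h1 x hx hxs
    have := h2 y hy hys
    have e' : (fun n => (Hom.id T).f (C.f (y n))) = x := funext e
    have h3 : (fun n => (Hom.id T).f (C.f (y n))) ∈ B := this
    rwa [e'] at h3
  · right
    refine ⟨C.φ false S, fun m => C.str _ _ _ (h1 m), fun x hx hxs => ?_⟩
    obtain ⟨y, hy, hys, e⟩ := C.lift _ _ h1 x hx hxs
    have := h2 y hy hys
    have e' : (fun n => (Hom.id T).f (C.f (y n))) = x := funext e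
    have h3 : ¬ (fun n => (Hom.id T).f (C.f (y n))) ∈ B := this
    rwa [e'] at h3

theorem limProj_step {k : ℕ} {T : ℕ → GT.{u}} (C : ∀ i, Cover (T (i+1)) (T i) (k+i)) (i : ℕ)
    (z : (limGT C).N) : (C i).f ((limProj C (i+1)).f z) = (limProj C i).f z := LimN.h z i

theorem UR.iUnion {T0 : GT.{u}} {A : ℕ → Set (ℕ → T0.N)} (h : ∀ i, UR T0 (A i)) :
    UR T0 (⋃ i, A i) := by
  intro T' f k
  choose TT CC hCC using h
  let P : ℕ → (T : GT.{u}) × Hom T T0 := fun i => Nat.rec ⟨T', f⟩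
    (fun i P => ⟨TT i P.1 P.2 (k+i), P.2.comp (CC i P.1 P.2 (k+i)).toHom⟩) i
  let C : ∀ i, Cover (P (i+1)).1 (P i).1 (k+i) := fun i => CC i (P i).1 (P i).2 (k+i)
  have hP : ∀ i q, (P (i+1)).2.f q = (P i).2.f ((C i).f q) := fun i q => rfl
  have hC : ∀ i, Clopen (P (i+1)).1 {y | (fun n => (P (i+1)).2.f (y n)) ∈ A i} :=
    fun i => hCC i (P i).1 (P i).2 (k+i)
  let TL := limGT (T := fun i => (P i).1) C
  let CL : Cover TL T' k := limCover (T := fun i => (P i).1) C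
  have hproj : ∀ i (z : TL.N), (P i).2.f ((limProj (T := fun i => (P i).1) C i).f z) = f.f (CL.f z) := by
    intro i z
    induction i with
    | zero => rfl
    | succ i ih => rw [hP, limProj_step (T := fun i => (P i).1) C, ih]
  have hopen : OpenP TL {y | (fun n => f.f (CL.f (y n))) ∈ ⋃ i, A i} := by
    intro y hy hyA
    obtain ⟨i, hi⟩ := Set.mem_iUnion.1 hyA
    let π := limProj (T := fun i => (P i).1) C (i+1)
    obtain ⟨n, hn⟩ := hC i _ (π.play hy)
    refine ⟨n, fun z hz e => Set.mem_iUnion.2 ⟨i, ?_⟩⟩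
    have := (hn _ (π.play hz) (by simp only [e])).1 (by
      show (fun n => (P (i+1)).2.f (π.f (y n))) ∈ A i
      simpa only [π, hproj] using hi)
    have h3 : (fun n => (P (i+1)).2.f (π.f (z n))) ∈ A i := this
    simpa only [π, hproj] using h3
  obtain ⟨T'', C'', hC''⟩ := unravel_open TL _ hopen k
  exact ⟨T'', CL.comp C'' (_root_.le_refl k), hC''⟩

end BD

namespace BD
open BD.GT

variable {α : Type u}

theorem length_playPrefix (p : ℕ → α) (n : ℕ) : (playPrefix p n).length = n := by
  simp [playPrefix]

theorem playPrefix_succ (p : ℕ → α) (n : ℕ) : playPrefix p (n+1) = playPrefix p n ++ [p n] := by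
  rw [playPrefix, List.ofFn_succ_last]; simp [playPrefix]

theorem playPrefix_prefix (p : ℕ → α) {m n : ℕ} (h : m ≤ n) : playPrefix p m <+: playPrefix p n := by
  induction n, h using Nat.le_induction with
  | base => exact List.prefix_rfl
  | succ n _ ih => rw [playPrefix_succ]; exact ih.trans (List.prefix_append _ _)

theorem prefix_playPrefix {p : ℕ → α} {n : ℕ} {γ : List α} (h : γ <+: playPrefix p n) :
    playPrefix p γ.length = γ := by
  have h1 := h.length_le
  rw [length_playPrefix] at h1
  have h2 := playPrefix_prefix p h1
  exact (List.prefix_of_prefix_length_le h2 h (by rw [length_playPrefix])).eq_of_length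
    (by rw [length_playPrefix])

theorem playPrefix_ext {p q : ℕ → α} (h : ∀ n, playPrefix p n = playPrefix q n) : p = q := by
  funext n
  have := h (n+1)
  rw [playPrefix_succ, playPrefix_succ, h n] at this
  simpa using this

theorem playPrefix_mem_succ {T : Set (List α)} {p : ℕ → α} (hp : p ∈ Body T) (n : ℕ) :
    playPrefix p (n+1) ∈ treeSucc T (playPrefix p n) :=
  ⟨hp _, playPrefix_prefix p (Nat.le_succ n), by simp [length_playPrefix]⟩

theorem treeSucc_eq {T : Set (List α)} {γ δ : List α} (h : δ ∈ treeSucc T γ) :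
    δ.dropLast = γ ∧ δ ≠ [] := by
  obtain ⟨h1, ⟨t, rfl⟩, h3⟩ := h
  have : t.length = 1 := by simpa using h3
  obtain ⟨a, rfl⟩ := List.length_eq_one_iff.1 this
  simp

theorem prefix_dropLast {γ δ : List α} (h : γ <+: δ) (hne : δ ≠ γ) : γ <+: δ.dropLast ∧ δ.length ≠ 0
    ∧ γ.length < δ.length := by
  obtain ⟨t, rfl⟩ := h
  have ht : t ≠ [] := by rintro rfl; simp at hne
  have := List.length_pos_iff.2 ht
  refine ⟨?_, by rw [List.length_append]; omega, by rw [List.length_append]; omega⟩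
  rw [List.dropLast_append_of_ne_nil ht]
  exact List.prefix_append _ _

/-- multi-valued winning strategies on trees of lists -/
structure DS (T : Set (List α)) (d : List α → Bool) (c : Bool) (γ : List α) (S : Set (List α))
    (X : Set (ℕ → α)) : Prop where
  mem : γ ∈ S
  mine : ∀ δ ∈ S, d δ = c → ∃ δ' ∈ treeSucc T δ, δ' ∈ S
  opp : ∀ δ ∈ S, d δ ≠ c → ∀ δ' ∈ treeSucc T δ, δ' ∈ S
  win : ∀ p ∈ Body T, playPrefix p γ.length = γ → (∀ n, γ.length ≤ n → playPrefix p n ∈ S) → p ∈ X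

section Alt
variable (T : Set (List α)) (d : List α → Bool) (γ : List α)

def AV (δ : List α) (o : Option (List α)) : Prop :=
  δ ∈ T ∧ γ <+: δ ∧ ∀ δ', o = some δ' → if d δ = true then δ' ∈ treeSucc T δ else δ' = δ

structure AN where
  δ : List α
  o : Option (List α)
  h : AV T d γ δ o

open Classical in
noncomputable def apd (δ : List α) (o : Option (List α)) : List α :=
  if o.isSome ∨ δ = γ then δ else δ.dropLast

open Classical in
noncomputable def apo (δ : List α) (o : Option (List α)) : Option (List α) :=
  if o.isSome ∨ δ = γ then none else some (if d δ.dropLast = true then δ else δ.dropLast)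

def alen (δ : List α) (o : Option (List α)) : ℕ :=
  2 * (δ.length - γ.length) + (if o.isSome then 1 else 0)

variable {T d γ}

theorem AV.par (hT : IsTree T) {δ : List α} {o : Option (List α)} (h : AV T d γ δ o) :
    AV T d γ (apd γ δ o) (apo d γ δ o) := by
  unfold apd apo
  split_ifs with h1 h2
  · exact ⟨h.1, h.2.1, by simp⟩
  · push Not at h1
    have := prefix_dropLast h.2.1 h1.2
    refine ⟨hT (List.dropLast_prefix _) h.1, this.1, ?_⟩
    rintro δ' e
    simp only [Option.some.injEq] at e
    subst e
    rw [if_pos h2]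
    exact ⟨h.1, List.dropLast_prefix _, by simp; omega⟩
  · push Not at h1
    have := prefix_dropLast h.2.1 h1.2
    refine ⟨hT (List.dropLast_prefix _) h.1, this.1, ?_⟩
    rintro δ' e
    simp only [Option.some.injEq] at e
    subst e
    rw [if_neg h2]

theorem alen_par {δ : List α} {o : Option (List α)} (h : AV T d γ δ o) :
    alen γ (apd γ δ o) (apo d γ δ o) = alen γ δ o - 1 := by
  unfold apd apo alen
  split_ifs with h1 h2 h3 h3 <;> simp_all
  all_goals
    have := prefix_dropLast h.2.1 h1
    omega

theorem AN.ext' {x y : AN T d γ} (h1 : x.δ = y.δ) (h2 : x.o = y.o) : x = y := by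
  cases x; cases y; simp only at h1 h2; subst h1 h2; rfl

noncomputable def altGT (hT : IsTree T) (hγ : γ ∈ T) : GT.{u} where
  N := AN T d γ
  len x := alen γ x.δ x.o
  par x := ⟨apd γ x.δ x.o, apo d γ x.δ x.o, x.h.par hT⟩
  root := ⟨γ, none, hγ, List.prefix_rfl, by simp⟩
  len_root := by simp [alen]
  eq_root := by
    rintro ⟨δ, o, h⟩ hl
    simp only [alen] at hl
    have ho : o = none := by
      cases o
      · rfl
      · simp at hl
    subst ho
    have : δ = γ := (h.2.1.eq_of_length_le (by simp at hl; omega)).symm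
    subst this
    rfl
  len_par x := alen_par x.h

variable (hT : IsTree T) (hγ : γ ∈ T)

theorem alt_len (x : AN T d γ) : (altGT hT hγ).len x = alen γ x.δ x.o := rfl

theorem alt_child1 {δ δ' : List α} (h : AV T d γ δ none) (h' : AV T d γ δ (some δ')) :
    (altGT hT hγ).Child (⟨δ, none, h⟩ : AN T d γ) (⟨δ, some δ', h'⟩ : AN T d γ) := by
  refine ⟨AN.ext' (by simp [altGT, apd]) (by simp [altGT, apo]), ?_⟩
  simp [altGT, alen]

theorem alt_child1' {δ : List α} (h : AV T d γ δ none) {z : AN T d γ}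
    (hc : (altGT hT hγ).Child (⟨δ, none, h⟩ : AN T d γ) z) : z.δ = δ ∧ ∃ δ', z.o = some δ' := by
  obtain ⟨δ', o, h'⟩ := z
  obtain ⟨h1, h2⟩ := hc
  simp only [altGT, AN.mk.injEq] at h1 h2
  cases o with
  | none =>
    simp [alen] at h2
    omega
  | some r => simpa [apd] using h1.1

theorem alt_child2 {δ r δ' : List α} (h : AV T d γ δ (some δ')) (h' : AV T d γ r none)
    (hr : r ∈ treeSucc T δ) (hd : d δ = true → δ' = r) :
    (altGT hT hγ).Child (⟨δ, some δ', h⟩ : AN T d γ) (⟨r, none, h'⟩ : AN T d γ) := by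
  have h1 := (treeSucc_eq hr).1
  have h2 := hr.2.2
  have h3 := h.2.1.length_le
  have hne : r ≠ γ := by rintro rfl; omega
  refine ⟨AN.ext' (by simp [altGT, apd, hne, h1]) ?_, ?_⟩
  · have h4 := h.2.2 δ' rfl
    simp only [altGT, apo, hne, h1]
    simp only [Option.isSome_none, Bool.false_eq_true, or_self, if_false, Option.some.injEq]
    split_ifs with hdd
    · exact (hd hdd).symm
    · rw [if_neg hdd] at h4; exact h4.symm
  · simp [altGT, alen]; omega

theorem alt_child2' {δ δ' : List α} (h : AV T d γ δ (some δ')) {z : AN T d γ}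
    (hc : (altGT hT hγ).Child (⟨δ, some δ', h⟩ : AN T d γ) z) :
    z.o = none ∧ z.δ ∈ treeSucc T δ ∧ (d δ = true → δ' = z.δ) := by
  obtain ⟨r, o, h'⟩ := z
  obtain ⟨h1, h2⟩ := hc
  simp only [altGT, AN.mk.injEq] at h1 h2
  cases o with
  | some r => simp [alen] at h2; omega
  | none =>
    have hne : r ≠ γ := by
      rintro rfl
      simp [apo] at h1
    simp only [apd, apo, hne, Option.isSome_none, Bool.false_eq_true, or_self, if_false,
      Option.some.injEq] at h1
    obtain ⟨rfl, h4⟩ := h1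
    have := prefix_dropLast h'.2.1 hne
    refine ⟨rfl, ⟨h'.1, List.dropLast_prefix _, by simp; omega⟩, fun hd => ?_⟩
    rw [if_pos hd] at h4; exact h4.symm

variable [Inhabited α]

def adec (y : ℕ → AN T d γ) (i : ℕ) : α := (y (2*i+2)).δ.getD i default

theorem adec_spec {y : ℕ → AN T d γ} (hy : (altGT hT hγ).IsPlay y) (i : ℕ) :
    (y (2*i)).o = none ∧ (y (2*i)).δ = playPrefix (adec y) (γ.length + i) := by
  have hl : ∀ i, alen γ (y i).δ (y i).o = i := hy.1
  have ho : ∀ i, (y (2*i)).o = none := by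
    intro i
    have := hl (2*i)
    unfold alen at this
    split_ifs at this with h
    · omega
    · simpa using h
  have hlen : ∀ i, (y (2*i)).δ.length = γ.length + i := by
    intro i
    have := hl (2*i)
    rw [ho] at this
    have h2 := (y (2*i)).h.2.1.length_le
    simp [alen] at this
    omega
  have hpre : ∀ i, (y (2*i)).δ <+: (y (2*(i+1))).δ := by
    intro i
    have h1 : apd γ (y (2*i+1)).δ (y (2*i+1)).o = (y (2*i)).δ := congrArg AN.δ (hy.2 (2*i))
    have h2 : apd γ (y (2*i+2)).δ (y (2*i+2)).o = (y (2*i+1)).δ := congrArg AN.δ (hy.2 (2*i+1))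
    have aux : ∀ δ o, apd γ δ o <+: δ := fun δ o => by
      unfold apd; split_ifs
      · exact List.prefix_rfl
      · exact List.dropLast_prefix _
    have h3 := aux (y (2*i+1)).δ (y (2*i+1)).o
    have h4 := aux (y (2*i+2)).δ (y (2*i+2)).o
    rw [h1] at h3; rw [h2] at h4
    exact h3.trans h4
  have hpre' : ∀ i j, i ≤ j → (y (2*i)).δ <+: (y (2*j)).δ := by
    intro i j h
    induction j, h using Nat.le_induction with
    | base => exact List.prefix_rfl
    | succ j _ ih => exact ih.trans (hpre j)
  refine ⟨ho i, List.ext_getElem (by rw [hlen, length_playPrefix]) fun n h1 h2 => ?_⟩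
  have h5 : n < (y (2*(n+1))).δ.length := by rw [hlen]; omega
  have : (playPrefix (adec y) (γ.length + i))[n] = (y (2*(n+1))).δ[n] := by
    simp only [playPrefix, List.getElem_ofFn, adec]
    exact List.getD_eq_getElem _ _ h5
  rw [this]
  rcases Nat.le_total i (n+1) with h | h
  · exact (hpre' _ _ h).getElem h1
  · exact ((hpre' _ _ h).getElem h5).symm

theorem adec_body {y : ℕ → AN T d γ} (hy : (altGT hT hγ).IsPlay y) : adec y ∈ Body T := by
  intro n
  refine hT (playPrefix_prefix _ (show n ≤ γ.length + n by omega)) ?_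
  rw [← (adec_spec hT hγ hy n).2]
  exact (y _).h.1

theorem alt_UR {T0 : Set (List α)} (hT0 : T ⊆ T0) {X : Set (ℕ → α)}
    (hX : @MeasurableSet (ℕ → α) (MeasurableSpace.generateFrom {A | IsOpenIn T0 A}) X) :
    UR (altGT (d := d) hT hγ) {y | adec y ∈ X} := by
  induction X, hX using MeasurableSpace.generateFrom_induction with
  | hC A hA _ =>
    apply UR.open
    obtain ⟨S, hS, rfl⟩ := hA
    intro y hy hyA
    have hyA' : adec y ∈ ⋃ γ ∈ S, cylinder T0 γ := hyA
    simp only [Set.mem_iUnion] at hyA'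
    obtain ⟨σ, hσ, h1, h2⟩ := hyA'
    refine ⟨2*σ.length, fun y' hy' e => ?_⟩
    show adec y' ∈ ⋃ γ ∈ S, cylinder T0 γ
    simp only [Set.mem_iUnion]
    refine ⟨σ, hσ, fun n => hT0 (adec_body hT hγ hy' n), ?_⟩
    have e1 := (adec_spec hT hγ hy σ.length).2
    have e2 := (adec_spec hT hγ hy' σ.length).2
    rw [e, e1] at e2
    have : σ <+: playPrefix (adec y') (γ.length + σ.length) := by
      rw [← e2]
      conv_lhs => rw [← h2]
      exact playPrefix_prefix _ (by omega)
    exact prefix_playPrefix this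
  | empty => exact UR.open fun y _ h => absurd h (Set.notMem_empty (adec y))
  | compl A _ ih => exact ih.compl
  | iUnion s _ ih =>
    have : {y : ℕ → (altGT (d := d) hT hγ).N | adec y ∈ ⋃ i, s i} =
        ⋃ i, {y : ℕ → (altGT (d := d) hT hγ).N | adec y ∈ s i} := by
      ext y
      rw [Set.mem_iUnion]
      exact Set.mem_iUnion
    rw [this]
    exact UR.iUnion ih

theorem alt_enc {p : ℕ → α} (hp : p ∈ Body T) (hpγ : playPrefix p γ.length = γ) :
    ∃ y : ℕ → AN T d γ, (altGT hT hγ).IsPlay y ∧ adec y = p := by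
  have hv : ∀ m, AV T d γ (playPrefix p (γ.length + m/2)) (if m % 2 = 0 then none else
      some (if d (playPrefix p (γ.length + m/2)) = true then playPrefix p (γ.length + m/2 + 1)
        else playPrefix p (γ.length + m/2))) := by
    intro m
    refine ⟨hp _, ?_, ?_⟩
    · conv_lhs => rw [← hpγ]
      exact playPrefix_prefix _ (by omega)
    · intro δ' e
      split_ifs at e with h1 h2
      · rw [if_pos h2]
        simp only [Option.some.injEq] at e
        rw [← e]; exact playPrefix_mem_succ hp _
      · rw [if_neg h2]
        simp only [Option.some.injEq] at e
        exact e.symm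
  let y : ℕ → AN T d γ := fun m => ⟨_, _, hv m⟩
  have hy : (altGT hT hγ).IsPlay y := by
    constructor
    · intro m
      simp only [altGT, alen, y, length_playPrefix]
      rcases Nat.mod_two_eq_zero_or_one m with h | h <;> simp [h] <;> omega
    · intro m
      rcases Nat.mod_two_eq_zero_or_one m with h | h
      · have h1 : (m+1)/2 = m/2 := by omega
        have h2 : (m+1) % 2 = 1 := by omega
        refine AN.ext' ?_ ?_
        · simp [altGT, apd, y, h1, h2]
        · simp [altGT, apo, y, h2, h]
      · have h1 : (m+1)/2 = m/2+1 := by omega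
        have h2 : (m+1) % 2 = 0 := by omega
        have h3 : playPrefix p (γ.length + (m/2 + 1)) ≠ γ := by
          intro e
          have := congrArg List.length e
          rw [length_playPrefix] at this; omega
        have h4 : (playPrefix p (γ.length + (m/2 + 1))).dropLast = playPrefix p (γ.length + m/2) := by
          rw [← add_assoc, playPrefix_succ]; simp
        refine AN.ext' ?_ ?_
        · simp [altGT, apd, y, h1, h2, h3, h4]
        · simp only [altGT, apo, y, h1, h2, h, h3, h4]
          simp [add_assoc]
  refine ⟨y, hy, ?_⟩
  apply playPrefix_ext
  intro n
  have h1 := (adec_spec hT hγ hy n).2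
  have h2 : (y (2*n)).δ = playPrefix p (γ.length + n) := by
    simp [y]
  rw [h1] at h2
  have h3 : playPrefix p n <+: playPrefix (adec y) (γ.length + n) := by
    rw [h2]; exact playPrefix_prefix _ (by omega)
  have := prefix_playPrefix h3
  rwa [length_playPrefix] at this

theorem alt_play_mem {b : Bool} {S : Set (AN T d γ)} (hS : ∀ m, IsStr (altGT hT hγ) b m S)
    {y : ℕ → AN T d γ} (hy : (altGT hT hγ).IsPlay y)
    (h : ∀ n, γ.length ≤ n → ∃ h, (⟨playPrefix (adec y) n, none, h⟩ : AN T d γ) ∈ S) (m : ℕ) : y m ∈ S := by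
  have heven : ∀ i, y (2*i) ∈ S := by
    intro i
    obtain ⟨h1, h2⟩ := h (γ.length + i) (by omega)
    have h3 := adec_spec hT hγ hy i
    have : y (2*i) = ⟨playPrefix (adec y) (γ.length + i), none, h1⟩ := AN.ext' h3.2 h3.1
    rw [this]; exact h2
  rcases Nat.even_or_odd' m with ⟨i, rfl | rfl⟩
  · exact heven i
  · have := (hS (2*(i+1))).par _ (heven (i+1)) (hy.1 _).le
    have e : (altGT hT hγ).par (y (2*(i+1))) = y (2*i+1) := hy.2 (2*i+1)
    rw [e] at this
    exact this

theorem turn_alt1 (b : Bool) {δ : List α} : turn b (alen γ δ none) ↔ b = true := by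
  simp [turn, alen]

theorem turn_alt2 (b : Bool) {δ δ' : List α} : turn b (alen γ δ (some δ')) ↔ b = false := by
  unfold turn alen; cases b <;> simp

theorem list_det (hT : IsTree T) (hγ : γ ∈ T) {T0 : Set (List α)} (hT0 : T ⊆ T0) {X : Set (ℕ → α)}
    (hX : @MeasurableSet (ℕ → α) (MeasurableSpace.generateFrom {A | IsOpenIn T0 A}) X) :
    (∃ S, DS T d true γ S X) ∨ (∃ S, DS T d false γ S Xᶜ) := by
  have hroot : AV T d γ γ none := ⟨hγ, List.prefix_rfl, by simp⟩
  have hv2 : ∀ {δ δ'}, AV T d γ δ none → δ' ∈ treeSucc T δ → AV T d γ δ' none := by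
    intro δ δ' h h'
    exact ⟨h'.1, h.2.1.trans h'.2.1, by simp⟩
  have hv1 : ∀ {δ δ'}, AV T d γ δ none → (if d δ = true then δ' ∈ treeSucc T δ else δ' = δ) →
      AV T d γ δ (some δ') := by
    intro δ δ' h h'
    refine ⟨h.1, h.2.1, ?_⟩
    rintro r e
    simp only [Option.some.injEq] at e
    subst e; exact h'
  rcases (alt_UR (d := d) hT hγ hT0 hX).det with ⟨S, hS, hw⟩ | ⟨S, hS, hw⟩
  · left
    refine ⟨{δ | ∃ h, (⟨δ, none, h⟩ : AN T d γ) ∈ S}, ⟨hroot, (hS 0).root⟩, ?_, ?_, ?_⟩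
    · rintro δ ⟨h, hm⟩ hd
      obtain ⟨⟨δ1, o, hz⟩, hc, hzS, -⟩ := (hS _).mine _ hm (Nat.lt_succ_self _) ((turn_alt1 true).2 rfl)
      obtain ⟨e1, δ', e2⟩ := alt_child1' hT hγ h hc
      simp only at e1 e2
      subst e1 e2
      have h1 := hz.2.2 δ' rfl
      rw [if_pos hd] at h1
      exact ⟨δ', h1, hv2 h h1, (hS _).opp _ hzS (Nat.lt_succ_self _)
        (fun ht => by simpa using (turn_alt2 true).1 ht) _ (alt_child2 hT hγ hz (hv2 h h1) h1 (fun _ => rfl))⟩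
    · rintro δ ⟨h, hm⟩ hd δ' hδ'
      obtain ⟨⟨δ1, o, hz⟩, hc, hzS, -⟩ := (hS _).mine _ hm (Nat.lt_succ_self _) ((turn_alt1 true).2 rfl)
      obtain ⟨e1, δ'', e2⟩ := alt_child1' hT hγ h hc
      simp only at e1 e2
      subst e1 e2
      exact ⟨hv2 h hδ', (hS _).opp _ hzS (Nat.lt_succ_self _)
        (fun ht => by simpa using (turn_alt2 true).1 ht) _
        (alt_child2 hT hγ hz (hv2 h hδ') hδ' (fun h => absurd h hd))⟩
    · intro p hp hpγ hps
      obtain ⟨y, hy, rfl⟩ := alt_enc (d := d) hT hγ hp hpγ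
      exact hw y hy (alt_play_mem hT hγ hS hy hps)
  · right
    refine ⟨{δ | ∃ h, (⟨δ, none, h⟩ : AN T d γ) ∈ S}, ⟨hroot, (hS 0).root⟩, ?_, ?_, ?_⟩
    · rintro δ ⟨h, hm⟩ hd
      have hz : AV T d γ δ (some δ) := hv1 h (by simp [hd])
      have hzS := (hS _).opp _ hm (Nat.lt_succ_self _)
        (fun ht => by simpa using (turn_alt1 false).1 ht) _ (alt_child1 hT hγ h hz)
      obtain ⟨⟨δ', o, hz'⟩, hc, hzS', -⟩ := (hS _).mine _ hzS (Nat.lt_succ_self _) ((turn_alt2 false).2 rfl)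
      obtain ⟨e1, e2, e3⟩ := alt_child2' hT hγ hz hc
      simp only at e1 e2 e3
      subst e1
      exact ⟨δ', e2, hz', hzS'⟩
    · rintro δ ⟨h, hm⟩ hd δ' hδ'
      have hd' : d δ = true := by simpa using hd
      have hz : AV T d γ δ (some δ') := hv1 h (by simp [hd', hδ'])
      have hzS := (hS _).opp _ hm (Nat.lt_succ_self _)
        (fun ht => by simpa using (turn_alt1 false).1 ht) _ (alt_child1 hT hγ h hz)
      obtain ⟨⟨δ'', o, hz'⟩, hc, hzS', -⟩ := (hS _).mine _ hzS (Nat.lt_succ_self _) ((turn_alt2 false).2 rfl)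
      obtain ⟨e1, e2, e3⟩ := alt_child2' hT hγ hz hc
      simp only at e1 e2 e3
      have := e3 hd'
      subst e1 this
      exact ⟨hz', hzS'⟩
    · intro p hp hpγ hps
      obtain ⟨y, hy, rfl⟩ := alt_enc (d := d) hT hγ hp hpγ
      exact hw y hy (alt_play_mem hT hγ hS hy hps)

end Alt
end BD

namespace BD

variable {α : Type u}

theorem take_playPrefix (p : ℕ → α) {m n : ℕ} (h : m ≤ n) :
    (playPrefix p n).take m = playPrefix p m := by
  have := List.prefix_iff_eq_take.1 (playPrefix_prefix p h)
  rw [length_playPrefix] at this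
  exact this.symm

theorem eventually_const {f : ℕ → ℕ} {m : ℕ} (h : ∀ n, m ≤ n → f (n+1) ≤ f n) :
    ∃ n0, m ≤ n0 ∧ ∀ n, n0 ≤ n → f n = f n0 := by
  obtain ⟨n0, hn0⟩ : ∃ n0 : {n // m ≤ n}, ∀ n : {n // m ≤ n}, f n0.1 ≤ f n.1 := by
    let k := sInf (Set.range fun n : {n // m ≤ n} => f n.1)
    have hk : k ∈ Set.range fun n : {n // m ≤ n} => f n.1 := Nat.sInf_mem ⟨f m, ⟨m, le_rfl⟩, rfl⟩
    obtain ⟨n0, hn0⟩ := hk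
    exact ⟨n0, fun n => by
      have : k ≤ f n.1 := Nat.sInf_le ⟨n, rfl⟩
      simp only at hn0; omega⟩
  refine ⟨n0.1, n0.2, fun n hn => ?_⟩
  refine le_antisymm ?_ (hn0 ⟨n, n0.2.trans hn⟩)
  induction n, hn using Nat.le_induction with
  | base => exact le_rfl
  | succ n hn ih => exact (h n (n0.2.trans hn)).trans ih

theorem mono_from {f : ℕ → ℕ} {m : ℕ} (h : ∀ n, m ≤ n → f (n+1) ≤ f n) {n : ℕ} (hn : m ≤ n) :
    f n ≤ f m := by
  induction n, hn using Nat.le_induction with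
  | base => exact le_rfl
  | succ n hn ih => exact (h n hn).trans ih

def Win (T : Set (List α)) (d : List α → Bool) (c : Bool) (X : Set (ℕ → α)) (γ : List α) : Prop :=
  ∃ S, DS T d c γ S X

theorem DS.mono {T : Set (List α)} {d : List α → Bool} {c : Bool} {γ : List α} {S : Set (List α)}
    {X Y : Set (ℕ → α)} (h : DS T d c γ S X) (hXY : ∀ p ∈ Body T, p ∈ X → p ∈ Y) : DS T d c γ S Y :=
  ⟨h.mem, h.mine, h.opp, fun p hp h1 h2 => hXY p hp (h.win p hp h1 h2)⟩

theorem DS.succ {T : Set (List α)} {d : List α → Bool} {c : Bool} {γ δ : List α} {S : Set (List α)}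
    {X : Set (ℕ → α)} (h : DS T d c γ S X) (hδ : δ ∈ treeSucc T γ) (hS : δ ∈ S) : DS T d c δ S X := by
  refine ⟨hS, h.mine, h.opp, fun p hp h1 h2 => ?_⟩
  have h3 : playPrefix p γ.length = γ := prefix_playPrefix (n := δ.length) (by rw [h1]; exact hδ.2.1)
  refine h.win p hp h3 fun n hn => ?_
  rcases hn.eq_or_lt with rfl | hlt
  · rw [h3]; exact h.mem
  · exact h2 n (by rw [hδ.2.2]; omega)

theorem unif1 (T : Set (List α)) (d : List α → Bool) (c : Bool) (X : Set (ℕ → α)) :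
    ∃ τ : List α → List α, (∀ γ, Win T d c X γ → d γ = c → τ γ ∈ treeSucc T γ ∧ Win T d c X (τ γ)) ∧
      ∀ p ∈ Body T, ∀ m, (∀ n, m ≤ n → Win T d c X (playPrefix p n)) →
        (∀ n, m ≤ n → d (playPrefix p n) = c → playPrefix p (n+1) = τ (playPrefix p n)) → p ∈ X := by
  classical
  have hex : ∀ γ, ∃ S, Win T d c X γ → DS T d c γ S X := fun γ => by
    by_cases h : Win T d c X γ
    · obtain ⟨S, hS⟩ := h; exact ⟨S, fun _ => hS⟩
    · exact ⟨∅, fun h' => absurd h' h⟩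
  choose σ hσ using hex
  let Q : List α → ℕ → Prop := fun γ k => k ≤ γ.length ∧ Win T d c X (γ.take k) ∧
    ∀ j, k ≤ j → j ≤ γ.length → γ.take j ∈ σ (γ.take k)
  have hQ : ∀ γ, Win T d c X γ → ∃ k, Q γ k := fun γ h => by
    refine ⟨γ.length, le_rfl, by simpa using h, fun j h1 h2 => ?_⟩
    have : j = γ.length := le_antisymm h2 h1
    subst this
    simpa using (hσ γ h).mem
  let κ : List α → ℕ := fun γ => sInf {k | Q γ k}
  have hκ : ∀ γ, Win T d c X γ → Q γ (κ γ) := fun γ h => Nat.sInf_mem (hQ γ h)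
  have hself : ∀ γ, Win T d c X γ → γ ∈ σ (γ.take (κ γ)) := fun γ h => by
    have := (hκ γ h).2.2 γ.length (hκ γ h).1 le_rfl
    simpa using this
  have hτ : ∀ γ, ∃ δ, Win T d c X γ → d γ = c → δ ∈ treeSucc T γ ∧ δ ∈ σ (γ.take (κ γ)) := fun γ => by
    by_cases h : Win T d c X γ ∧ d γ = c
    · obtain ⟨δ, h1, h2⟩ := (hσ _ (hκ γ h.1).2.1).mine γ (hself γ h.1) h.2
      exact ⟨δ, fun _ _ => ⟨h1, h2⟩⟩
    · exact ⟨γ, fun h1 h2 => absurd ⟨h1, h2⟩ h⟩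
  choose τ hτ using hτ
  have hSwin : ∀ γ, Win T d c X γ → ∀ δ ∈ treeSucc T γ, δ ∈ σ (γ.take (κ γ)) → Win T d c X δ := by
    intro γ h δ hδ hS
    have h0 := hσ _ (hκ γ h).2.1
    refine ⟨σ (γ.take (κ γ)), hS, h0.mine, h0.opp, fun p hp h1 h2 => ?_⟩
    have h3 : playPrefix p γ.length = γ := prefix_playPrefix (n := δ.length) (by rw [h1]; exact hδ.2.1)
    have hl : (γ.take (κ γ)).length = κ γ := by
      rw [List.length_take]; exact min_eq_left (hκ γ h).1
    refine h0.win p hp ?_ fun n hn => ?_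
    · rw [hl, ← take_playPrefix p (hκ γ h).1, h3]
    · rw [hl] at hn
      by_cases hn' : n ≤ γ.length
      · have := (hκ γ h).2.2 n hn hn'
        rw [← take_playPrefix p hn', h3]; exact this
      · exact h2 n (by rw [hδ.2.2]; omega)
  refine ⟨τ, fun γ h hd => ⟨(hτ γ h hd).1, hSwin γ h _ (hτ γ h hd).1 (hτ γ h hd).2⟩, ?_⟩
  intro p hp m hW hf
  have hdec : ∀ n, m ≤ n → κ (playPrefix p (n+1)) ≤ κ (playPrefix p n) := by
    intro n hn
    have hk := hκ _ (hW n hn)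
    have hkl : κ (playPrefix p n) ≤ n := by
      have := hk.1; rwa [length_playPrefix] at this
    apply Nat.sInf_le
    have et : (playPrefix p (n+1)).take (κ (playPrefix p n)) = (playPrefix p n).take (κ (playPrefix p n)) := by
      rw [take_playPrefix p hkl, take_playPrefix p (hkl.trans (Nat.le_succ n))]
    refine ⟨by rw [length_playPrefix]; omega, by rw [et]; exact hk.2.1, fun j h1 h2 => ?_⟩
    rw [length_playPrefix] at h2
    rw [et, take_playPrefix p h2]
    rcases h2.eq_or_lt with rfl | hlt
    · by_cases hd : d (playPrefix p n) = c
      · rw [hf n hn hd]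
        exact (hτ _ (hW n hn) hd).2
      · exact (hσ _ hk.2.1).opp _ (hself _ (hW n hn)) hd _ (playPrefix_mem_succ hp n)
    · have := hk.2.2 j h1 (by rw [length_playPrefix]; omega)
      rwa [take_playPrefix p (show j ≤ n by omega)] at this
  obtain ⟨n0, hn0, hc⟩ := eventually_const (f := fun n => κ (playPrefix p n)) hdec
  have hk0 := hκ _ (hW n0 hn0)
  have hkl : κ (playPrefix p n0) ≤ n0 := by
    have := hk0.1; rwa [length_playPrefix] at this
  have e0 : (playPrefix p n0).take (κ (playPrefix p n0)) = playPrefix p (κ (playPrefix p n0)) :=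
    take_playPrefix p hkl
  have hS0 := hσ _ hk0.2.1
  rw [e0] at hS0
  refine hS0.win p hp (by rw [length_playPrefix]) fun j hj => ?_
  rw [length_playPrefix] at hj
  have hk := (hκ _ (hW (n0 + j) (by omega))).2.2 j
  rw [hc (n0+j) (by omega), length_playPrefix, take_playPrefix p (by omega),
    take_playPrefix p (by omega)] at hk
  exact hk hj (by omega)

theorem unif (T : Set (List α)) (d : List α → Bool) (c : Bool) (X : ℕ → Set (ℕ → α))
    (hX : ∀ i j, i ≤ j → X i ⊆ X j) (hW : ∀ γ ∈ T, ∃ i, Win T d c (X i) γ) :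
    ∃ s : List α → List α, (∀ γ ∈ T, d γ = c → s γ ∈ treeSucc T γ) ∧
      ∀ p ∈ Body T, ∀ m i, Win T d c (X i) (playPrefix p m) →
        (∀ n, m ≤ n → d (playPrefix p n) = c → playPrefix p (n+1) = s (playPrefix p n)) → p ∈ X i := by
  choose τ h1 h2 using fun i => unif1 T d c (X i)
  let rk : List α → ℕ := fun γ => sInf {i | Win T d c (X i) γ}
  have hrk : ∀ γ ∈ T, Win T d c (X (rk γ)) γ := fun γ h => Nat.sInf_mem (hW γ h)
  refine ⟨fun γ => τ (rk γ) γ, fun γ h hd => (h1 _ γ (hrk γ h) hd).1, ?_⟩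
  intro p hp m i hi hf
  have hdec : ∀ n, m ≤ n → rk (playPrefix p (n+1)) ≤ rk (playPrefix p n) := by
    intro n hn
    apply Nat.sInf_le
    show Win T d c (X (rk (playPrefix p n))) (playPrefix p (n+1))
    by_cases hd : d (playPrefix p n) = c
    · rw [hf n hn hd]
      exact (h1 _ _ (hrk _ (hp n)) hd).2
    · obtain ⟨S, hS⟩ := hrk _ (hp n)
      have hs := playPrefix_mem_succ hp n
      exact ⟨S, hS.succ hs (hS.opp _ hS.mem hd _ hs)⟩
  obtain ⟨n0, hn0, hc⟩ := eventually_const (f := fun n => rk (playPrefix p n)) hdec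
  have hle : rk (playPrefix p n0) ≤ i :=
    (mono_from (f := fun n => rk (playPrefix p n)) hdec hn0).trans (Nat.sInf_le hi)
  refine hX _ _ hle (h2 _ p hp n0 (fun n hn => ?_) fun n hn hd => ?_)
  · rw [← hc n hn]; exact hrk _ (hp n)
  · rw [← hc n hn]; exact hf n (hn0.trans hn) hd

/-- Values and uniform optimal strategies for the zero-sum game with payoff `V`. -/
theorem vals [Inhabited α] {T0 T : Set (List α)} (hT0 : T ⊆ T0) (hT : IsTree T) (hpr : IsPruned T)
    (d : List α → Bool) (N : ℕ) (V : (ℕ → α) → ℕ) (hV : ∀ p, V p ≤ N)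
    (hm : ∀ i, @MeasurableSet (ℕ → α) (MeasurableSpace.generateFrom {A | IsOpenIn T0 A})
      {p ∈ Body T0 | V p ≤ i}) :
    ∃ (val : List α → ℕ) (s : List α → List α), (∀ γ ∈ T, val γ ≤ N) ∧ (∀ γ ∈ T, s γ ∈ treeSucc T γ) ∧
      (∀ p ∈ Body T, ∀ m, (∀ n, m ≤ n → d (playPrefix p n) = true →
        playPrefix p (n+1) = s (playPrefix p n)) → V p ≤ val (playPrefix p m)) ∧
      (∀ p ∈ Body T, ∀ m, (∀ n, m ≤ n → d (playPrefix p n) = false →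
        playPrefix p (n+1) = s (playPrefix p n)) → val (playPrefix p m) ≤ V p) := by
  have triv : ∀ c γ (X : Set (ℕ → α)), γ ∈ T → (∀ p, p ∈ X) → Win T d c X γ := by
    intro c γ X hγ hX
    refine ⟨T, hγ, fun δ hδ _ => ?_, fun δ _ _ δ' h => h.1, fun p _ _ _ => hX p⟩
    obtain ⟨δ', h⟩ := hpr δ hδ
    exact ⟨δ', h, h.1⟩
  let XA : ℕ → Set (ℕ → α) := fun i => {p | V p ≤ i}
  let XB : ℕ → Set (ℕ → α) := fun i => {p | N ≤ V p + i}
  have hA0 : ∀ γ ∈ T, Win T d true (XA N) γ := fun γ h => triv _ _ _ h hV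
  obtain ⟨sA, hsA, hA⟩ := unif T d true XA (fun i j h p hp => le_trans (show V p ≤ i from hp) h)
    (fun γ h => ⟨N, hA0 γ h⟩)
  obtain ⟨sB, hsB, hB⟩ := unif T d false XB
    (fun i j h p hp => by have : N ≤ V p + i := hp; show N ≤ V p + j; omega)
    (fun γ h => ⟨N, triv _ _ _ h fun p => by show N ≤ V p + N; omega⟩)
  let val : List α → ℕ := fun γ => sInf {i | Win T d true (XA i) γ}
  have hval : ∀ γ ∈ T, Win T d true (XA (val γ)) γ := fun γ h =>
    Nat.sInf_mem (s := {i | Win T d true (XA i) γ}) ⟨N, hA0 γ h⟩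
  have hvN : ∀ γ ∈ T, val γ ≤ N := fun γ h => Nat.sInf_le (hA0 γ h)
  have hvalB : ∀ γ ∈ T, Win T d false (XB (N - val γ)) γ := by
    intro γ h
    have hN := hvN γ h
    by_cases h0 : val γ = 0
    · exact triv _ _ _ h fun p => by show N ≤ V p + (N - val γ); omega
    · rcases list_det (d := d) hT h hT0 (hm (val γ - 1)) with ⟨S, hS⟩ | ⟨S, hS⟩
      · exfalso
        have : Win T d true (XA (val γ - 1)) γ := ⟨S, hS.mono fun p _ hp => hp.2⟩
        have h2 : val γ ≤ val γ - 1 := Nat.sInf_le this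
        omega
      · refine ⟨S, hS.mono fun p hp hpc => ?_⟩
        show N ≤ V p + (N - val γ)
        by_contra hlt
        exact hpc ⟨fun n => hT0 (hp n), by omega⟩
  refine ⟨val, fun γ => if d γ = true then sA γ else sB γ, hvN, ?_, ?_, ?_⟩
  · intro γ h
    by_cases hd : d γ = true
    · simp only [hd, if_true]; exact hsA γ h hd
    · have hd' : d γ = false := by simpa using hd
      simp only [hd]; exact hsB γ h hd'
  · intro p hp m hf
    refine hA p hp m _ (hval _ (hp m)) fun n hn hd => ?_
    have := hf n hn hd
    beta_reduce at this
    rwa [if_pos hd] at this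
  · intro p hp m hf
    have h3 := hB p hp m _ (hvalB _ (hp m)) fun n hn hd => by
      have := hf n hn hd
      beta_reduce at this
      rwa [if_neg (by simp [hd])] at this
    have h3' : N ≤ V p + (N - val (playPrefix p m)) := h3
    have := hvN _ (hp m)
    omega

section WW
variable {N : Type u} (E : N → N → Prop) (F : Set N)

inductive Rch (Z : Set N) : ℕ → N → Prop
  | zero (γ) : γ ∈ Z → γ ∈ F → Rch Z 0 γ
  | succ (k γ δ) : γ ∈ Z → E γ δ → Rch Z k δ → Rch Z (k+1) γ

variable {E F}
theorem Rch.mem {Z : Set N} {k : ℕ} {γ : N} (h : Rch E F Z k γ) : γ ∈ Z := by cases h <;> assumption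

theorem Rch.mono {Z Z' : Set N} {k : ℕ} {γ : N} (h : Rch E F Z k γ) (hZ : Z ⊆ Z') : Rch E F Z' k γ := by
  induction h with
  | zero γ h1 h2 => exact Rch.zero γ (hZ h1) h2
  | succ k γ δ h1 h2 _ ih => exact Rch.succ k γ δ (hZ h1) h2 ih

theorem exists_w (own : N → Bool) (val : N → ℕ) (n k : ℕ) : ∀ (i : ℕ) (B : Set N), i + k = n + 1 →
    (∀ γ ∈ B, ∃ k, Rch E F B k γ) → (∀ γ ∈ B, γ ∈ F → i ≤ val γ ∧ val γ ≤ n) →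
    ∃ w : N → ℕ, (∀ γ ∈ B, i ≤ w γ) ∧ (∀ γ ∈ B, γ ∈ F → w γ = val γ) ∧
      (∀ γ ∈ B, γ ∉ F → own γ = true → ∀ δ ∈ B, E γ δ → w γ ≤ w δ) ∧
      (∀ γ ∈ B, γ ∉ F → own γ = false → ∀ δ ∈ B, E γ δ → w δ ≤ w γ) ∧
      (∀ γ ∈ B, ∃ k, Rch E F {δ ∈ B | w δ = w γ} k γ) := by
  classical
  induction k with
  | zero =>
    intro i B hi hB hv
    have hne : ∀ k γ, Rch E F B k γ → False := by
      intro k γ h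
      induction h with
      | zero γ h1 h2 => have := hv γ h1 h2; omega
      | succ _ _ _ _ _ _ ih => exact ih
    have hB' : ∀ γ, γ ∉ B := fun γ h => by obtain ⟨k, hk⟩ := hB γ h; exact hne k γ hk
    exact ⟨fun _ => 0, fun γ h => absurd h (hB' γ), fun γ h => absurd h (hB' γ),
      fun γ h => absurd h (hB' γ), fun γ h => absurd h (hB' γ), fun γ h => absurd h (hB' γ)⟩
  | succ k ih =>
    intro i B hi hB hv
    let good : Set N → Prop := fun Z => Z ⊆ B ∧ (∀ γ ∈ Z, γ ∈ F → i < val γ) ∧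
      (∀ γ ∈ Z, γ ∉ F → own γ = true → ∀ δ ∈ B, E γ δ → δ ∈ Z) ∧ ∀ γ ∈ Z, ∃ k, Rch E F Z k γ
    let B' : Set N := {γ | ∃ Z, good Z ∧ γ ∈ Z}
    have hsubB : ∀ Z, good Z → Z ⊆ B' := fun Z h γ hγ => ⟨Z, h, hγ⟩
    have hg : good B' := by
      refine ⟨?_, ?_, ?_, ?_⟩
      · rintro γ ⟨Z, h, hγ⟩; exact h.1 hγ
      · rintro γ ⟨Z, h, hγ⟩; exact h.2.1 γ hγ
      · rintro γ ⟨Z, h, hγ⟩ h1 h2 δ h3 h4; exact ⟨Z, h, h.2.2.1 γ hγ h1 h2 δ h3 h4⟩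
      · rintro γ ⟨Z, h, hγ⟩
        obtain ⟨k, hk⟩ := h.2.2.2 γ hγ
        exact ⟨k, hk.mono (hsubB Z h)⟩
    obtain ⟨hg1, hg2, hg3, hg4⟩ := hg
    obtain ⟨w', hw1, hw2, hw3, hw4, hw5⟩ := ih (i+1) B' (by omega) hg4
      (fun γ h hF => ⟨hg2 γ h hF, (hv γ (hg1 h) hF).2⟩)
    have hAF : ∀ γ ∈ B, γ ∉ B' → γ ∈ F → val γ = i := by
      intro γ hγ hA hF
      by_contra hne
      apply hA
      have hlt : i < val γ := lt_of_le_of_ne (hv γ hγ hF).1 (Ne.symm hne)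
      refine hsubB {γ} ⟨by simpa using hγ, ?_, ?_, ?_⟩ rfl
      · rintro _ rfl _; exact hlt
      · rintro _ rfl h; exact absurd hF h
      · rintro _ rfl; exact ⟨0, Rch.zero _ rfl hF⟩
    have hAb : ∀ γ ∈ B, γ ∉ B' → γ ∉ F → own γ = false → ∀ δ ∈ B, E γ δ → δ ∉ B' := by
      intro γ hγ hA hF ho δ hδ hE hδ'
      apply hA
      refine hsubB (insert γ B') ⟨Set.insert_subset hγ hg1, ?_, ?_, ?_⟩ (Set.mem_insert _ _)
      · rintro z (rfl | hz) h
        · exact absurd h hF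
        · exact hg2 z hz h
      · rintro z (rfl | hz) h h' y hy hzy
        · simp [ho] at h'
        · exact Or.inr (hg3 z hz h h' y hy hzy)
      · rintro z (rfl | hz)
        · obtain ⟨k, hk⟩ := hg4 δ hδ'
          exact ⟨k+1, Rch.succ k _ δ (Set.mem_insert _ _) hE (hk.mono (Set.subset_insert _ _))⟩
        · obtain ⟨k, hk⟩ := hg4 z hz
          exact ⟨k, hk.mono (Set.subset_insert _ _)⟩
    have hAr : ∀ γ ∈ B, γ ∉ B' → ∃ k, Rch E F (B \ B') k γ := by
      intro γ0 hγ0 hA0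
      by_contra hno
      let Y : Set N := {γ | γ ∈ B ∧ γ ∉ B' ∧ ¬ ∃ k, Rch E F (B \ B') k γ}
      have hYF : ∀ γ ∈ Y, γ ∉ F := fun γ hγ hF => hγ.2.2 ⟨0, Rch.zero γ ⟨hγ.1, hγ.2.1⟩ hF⟩
      have hYc : ∀ γ ∈ Y, ∀ δ ∈ B, E γ δ → δ ∈ B' ∪ Y := by
        intro γ hγ δ hδ hE
        by_cases h : δ ∈ B'
        · exact Or.inl h
        · refine Or.inr ⟨hδ, h, fun ⟨k, hk⟩ => hγ.2.2 ⟨k+1, Rch.succ k γ δ ⟨hγ.1, hγ.2.1⟩ hE hk⟩⟩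
      apply hA0
      refine hsubB (B' ∪ Y) ⟨?_, ?_, ?_, ?_⟩ (Or.inr ⟨hγ0, hA0, hno⟩)
      · rintro γ (h | h)
        · exact hg1 h
        · exact h.1
      · rintro γ (h | h) hF
        · exact hg2 γ h hF
        · exact absurd hF (hYF γ h)
      · rintro γ (h | h) hF ho δ hδ hE
        · exact Or.inl (hg3 γ h hF ho δ hδ hE)
        · exact hYc γ h δ hδ hE
      · have key : ∀ k γ, Rch E F B k γ → γ ∈ B' ∪ Y → ∃ k, Rch E F (B' ∪ Y) k γ := by
          intro k γ h
          induction h with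
          | zero γ h1 h2 => exact fun h => ⟨0, Rch.zero γ h h2⟩
          | succ k γ δ h1 h2 h3 ih =>
            rintro (h | h)
            · obtain ⟨k, hk⟩ := hg4 γ h
              exact ⟨k, hk.mono Set.subset_union_left⟩
            · obtain ⟨k, hk⟩ := ih (hYc γ h δ h3.mem h2)
              exact ⟨k+1, Rch.succ k γ δ (Or.inr h) h2 hk⟩
        intro γ hγ
        have hγB : γ ∈ B := by
          rcases hγ with h | h
          · exact hg1 h
          · exact h.1
        obtain ⟨k, hk⟩ := hB γ hγB
        exact key k γ hk hγ
    refine ⟨fun γ => if γ ∈ B' then w' γ else i, ?_, ?_, ?_, ?_, ?_⟩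
    · intro γ _
      by_cases h : γ ∈ B'
      · simp only [h, if_true]; have := hw1 γ h; omega
      · simp [h]
    · intro γ hγ hF
      by_cases h : γ ∈ B'
      · simp only [h, if_true]; exact hw2 γ h hF
      · simp only [h, if_false]; exact (hAF γ hγ h hF).symm
    · intro γ hγ hF ho δ hδ hE
      by_cases h : γ ∈ B'
      · have h' := hg3 γ h hF ho δ hδ hE
        simp only [h, h', if_true]; exact hw3 γ h hF ho δ h' hE
      · simp only [h, if_false]
        split_ifs with h'
        · have := hw1 δ h'; omega
        · exact le_rfl
    · intro γ hγ hF ho δ hδ hE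
      by_cases h : γ ∈ B'
      · simp only [h, if_true]
        split_ifs with h'
        · exact hw4 γ h hF ho δ h' hE
        · have := hw1 γ h; omega
      · have h' := hAb γ hγ h hF ho δ hδ hE
        simp [h, h']
    · intro γ hγ
      by_cases h : γ ∈ B'
      · obtain ⟨k, hk⟩ := hw5 γ h
        refine ⟨k, hk.mono ?_⟩
        rintro δ ⟨h1, h2⟩
        exact ⟨hg1 h1, by simp only [h, h1, if_true]; exact h2⟩
      · obtain ⟨k, hk⟩ := hAr γ hγ h
        refine ⟨k, hk.mono ?_⟩
        rintro δ ⟨h1, h2⟩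
        exact ⟨h1, by simp [h, h2]⟩

end WW

/-- The core equilibrium construction on the tree of alive nodes. -/
theorem core [Inhabited α] {T0 T : Set (List α)} (hT0 : T ⊆ T0) (hT : IsTree T) (hpr : IsPruned T)
    (d : List α → Bool) (N : ℕ) (V : (ℕ → α) → ℕ) (hV : ∀ p, V p ≤ N)
    (hm : ∀ i, @MeasurableSet (ℕ → α) (MeasurableSpace.generateFrom {A | IsOpenIn T0 A})
      {p ∈ Body T0 | V p ≤ i})
    (F : Set (List α)) (hFup : ∀ γ ∈ F, ∀ δ ∈ treeSucc T γ, δ ∈ F)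
    (hF0 : ∀ p ∈ Body T, ∀ n, playPrefix p n ∈ F → V p ≠ 0)
    (hF1 : ∀ p ∈ Body T, V p ≠ 0 → ∃ n, playPrefix p n ∈ F)
    (hF2 : ∀ γ ∈ T, ∃ k, Rch (fun γ δ => δ ∈ treeSucc T γ) F T k γ) :
    ∃ (w : List α → ℕ) (s : List α → List α), (∀ γ ∈ T, s γ ∈ treeSucc T γ) ∧
      (∀ p ∈ Body T, ∀ m, (∀ n, m ≤ n → d (playPrefix p n) = true →
        playPrefix p (n+1) = s (playPrefix p n)) → V p ≠ 0 → V p ≤ w (playPrefix p m)) ∧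
      (∀ p ∈ Body T, ∀ m, (∀ n, m ≤ n → d (playPrefix p n) = false →
        playPrefix p (n+1) = s (playPrefix p n)) → V p ≠ 0 → w (playPrefix p m) ≤ V p) ∧
      (∀ p ∈ Body T, ∀ m, (∀ n, m ≤ n → playPrefix p (n+1) = s (playPrefix p n)) → V p ≠ 0) := by
  classical
  obtain ⟨val, s0, hvN, hs0, hvA, hvB⟩ := vals hT0 hT hpr d N V hV hm
  obtain ⟨w, -, hw2, hw3, hw4, hw5⟩ := exists_w (E := fun γ δ => δ ∈ treeSucc T γ) (F := F) d val N
    (N+1) 0 T (by omega) hF2 (fun γ h _ => ⟨Nat.zero_le _, hvN γ h⟩)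
  let E : List α → List α → Prop := fun γ δ => δ ∈ treeSucc T γ
  let dist : List α → ℕ := fun γ => sInf {k | Rch E F {δ ∈ T | w δ = w γ} k γ}
  have hdist : ∀ γ ∈ T, Rch E F {δ ∈ T | w δ = w γ} (dist γ) γ := fun γ h =>
    Nat.sInf_mem (s := {k | Rch E F {δ ∈ T | w δ = w γ} k γ}) (hw5 γ h)
  have hnext : ∀ γ, ∃ δ, γ ∈ T → γ ∉ F → δ ∈ treeSucc T γ ∧ w δ = w γ ∧ dist δ < dist γ := by
    intro γ
    by_cases h : γ ∈ T ∧ γ ∉ F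
    · have hd := hdist γ h.1
      generalize hk : dist γ = k at hd
      cases hd with
      | zero _ _ h2 => exact absurd h2 h.2
      | succ k _ δ h1 h2 h3 =>
        have hwδ : w δ = w γ := h3.mem.2
        refine ⟨δ, fun _ _ => ⟨h2, hwδ, ?_⟩⟩
        have : dist δ ≤ k := Nat.sInf_le (by show Rch E F {δ' ∈ T | w δ' = w δ} k δ; rw [hwδ]; exact h3)
        omega
    · exact ⟨γ, fun h1 h2 => absurd ⟨h1, h2⟩ h⟩
  choose nx hnx using hnext
  let s : List α → List α := fun γ => if γ ∈ F then s0 γ else nx γ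
  have hFplay : ∀ p ∈ Body T, ∀ j, playPrefix p j ∈ F → ∀ n, j ≤ n → playPrefix p n ∈ F := by
    intro p hp j hj n hn
    induction n, hn using Nat.le_induction with
    | base => exact hj
    | succ n _ ih => exact hFup _ ih _ (playPrefix_mem_succ hp n)
  have hfirst : ∀ p ∈ Body T, ∀ m, V p ≠ 0 → ∃ j, m ≤ j ∧ playPrefix p j ∈ F ∧
      ∀ n, m ≤ n → n < j → playPrefix p n ∉ F := by
    intro p hp m hV
    obtain ⟨n, hn⟩ := hF1 p hp hV
    have hex : ∃ j, m ≤ j ∧ playPrefix p j ∈ F := ⟨m + n, by omega, hFplay p hp n hn _ (by omega)⟩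
    refine ⟨Nat.find hex, (Nat.find_spec hex).1, (Nat.find_spec hex).2, fun n h1 h2 h3 => ?_⟩
    exact Nat.find_min hex h2 ⟨h1, h3⟩
  refine ⟨w, s, ?_, ?_, ?_, ?_⟩
  · intro γ hγ
    by_cases h : γ ∈ F
    · simp only [s, h, if_true]; exact hs0 γ hγ
    · simp only [s, h, if_false]; exact (hnx γ hγ h).1
  · intro p hp m hf hV
    obtain ⟨j, hj, hjF, hjm⟩ := hfirst p hp m hV
    have h1 : V p ≤ w (playPrefix p j) := by
      rw [hw2 _ (hp j) hjF]
      refine hvA p hp j fun n hn hd => ?_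
      have := hf n (hj.trans hn) hd
      simpa only [s, hFplay p hp j hjF n hn, if_true] using this
    refine h1.trans ?_
    have : ∀ n, m ≤ n → n ≤ j → w (playPrefix p n) ≤ w (playPrefix p m) := by
      intro n hn
      induction n, hn using Nat.le_induction with
      | base => exact fun _ => le_rfl
      | succ n hn ih =>
        intro hnj
        refine le_trans ?_ (ih (by omega))
        have hnF := hjm n hn (by omega)
        cases hd : d (playPrefix p n) with
        | false => exact hw4 _ (hp n) hnF hd _ (hp _) (playPrefix_mem_succ hp n)
        | true =>
          have := hf n hn hd
          simp only [s, hnF, if_false] at this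
          rw [this]; exact (hnx _ (hp n) hnF).2.1.le
    exact this j hj le_rfl
  · intro p hp m hf hV
    obtain ⟨j, hj, hjF, hjm⟩ := hfirst p hp m hV
    have h1 : w (playPrefix p j) ≤ V p := by
      rw [hw2 _ (hp j) hjF]
      refine hvB p hp j fun n hn hd => ?_
      have := hf n (hj.trans hn) hd
      simpa only [s, hFplay p hp j hjF n hn, if_true] using this
    refine le_trans ?_ h1
    have : ∀ n, m ≤ n → n ≤ j → w (playPrefix p m) ≤ w (playPrefix p n) := by
      intro n hn
      induction n, hn using Nat.le_induction with
      | base => exact fun _ => le_rfl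
      | succ n hn ih =>
        intro hnj
        refine le_trans (ih (by omega)) ?_
        have hnF := hjm n hn (by omega)
        cases hd : d (playPrefix p n) with
        | true => exact hw3 _ (hp n) hnF hd _ (hp _) (playPrefix_mem_succ hp n)
        | false =>
          have := hf n hn hd
          simp only [s, hnF, if_false] at this
          rw [this]; exact (hnx _ (hp n) hnF).2.1.ge
    exact this j hj le_rfl
  · intro p hp m hf
    have : ∀ k m, (∀ n, m ≤ n → playPrefix p (n+1) = s (playPrefix p n)) →
        dist (playPrefix p m) ≤ k → ∃ n, playPrefix p n ∈ F := by
      intro k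
      induction k with
      | zero =>
        intro m hf hk
        by_cases hF : playPrefix p m ∈ F
        · exact ⟨m, hF⟩
        · have := (hnx _ (hp m) hF).2.2
          omega
      | succ k ih =>
        intro m hf hk
        by_cases hF : playPrefix p m ∈ F
        · exact ⟨m, hF⟩
        · have h1 := (hnx _ (hp m) hF).2.2
          have h2 := hf m le_rfl
          simp only [s, hF, if_false] at h2
          refine ih (m+1) (fun n hn => hf n (by omega)) ?_
          rw [h2]; omega
    obtain ⟨n, hn⟩ := this _ m hf le_rfl
    exact hF0 p hp n hn

end BD

namespace BD

variable {α : Type u}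

theorem playPrefix_get (p : ℕ → α) {n i : ℕ} (h : i < (playPrefix p n).length) :
    (playPrefix p n)[i] = p i := by simp [playPrefix]

theorem listExtend_prefix (γ : List α) (p : ℕ → α) (j : ℕ) :
    playPrefix (listExtend γ p) (γ.length + j) = γ ++ playPrefix p j := by
  induction j with
  | zero =>
    apply List.ext_getElem
    · simp [length_playPrefix]
    · intro i h1 h2
      rw [length_playPrefix] at h1
      rw [playPrefix_get]
      have : i < γ.length := by omega
      simp [listExtend, this, playPrefix]
  | succ j ih =>
    rw [← add_assoc, playPrefix_succ, ih, playPrefix_succ, List.append_assoc]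
    simp [listExtend]

theorem listExtend_body {T : Set (List α)} (hT : IsTree T) {γ : List α} {p : ℕ → α}
    (hp : p ∈ Body {δ | γ ++ δ ∈ T}) : listExtend γ p ∈ Body T := by
  intro n
  refine hT (playPrefix_prefix _ (show n ≤ γ.length + n by omega)) ?_
  rw [listExtend_prefix]
  exact hp n

theorem induced_prefix [Inhabited α] {T : Set (List α)} {s : List α → List α} (hs : IsProfile T s)
    (h0 : [] ∈ T) (j : ℕ) : iterNode s [] j ∈ T ∧ playPrefix (inducedPlay s) j = iterNode s [] j := by
  have hmem : ∀ j, iterNode s [] j ∈ T := by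
    intro j
    induction j with
    | zero => exact h0
    | succ j ih => exact (hs _ ih).1
  have hlen : ∀ j, (iterNode s [] j).length = j := by
    intro j
    induction j with
    | zero => rfl
    | succ j ih =>
      have := (hs _ (hmem j)).2.2
      rw [ih] at this; exact this
  refine ⟨hmem j, ?_⟩
  induction j with
  | zero => rfl
  | succ j ih =>
    rw [playPrefix_succ, ih]
    obtain ⟨t, ht⟩ := (hs _ (hmem j)).2.1
    have e : iterNode s [] (j+1) = iterNode s [] j ++ t := ht.symm
    have h1 := hlen (j+1)
    rw [e, List.length_append, hlen j] at h1
    have ht1 : t.length = 1 := by omega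
    obtain ⟨a, rfl⟩ := List.length_eq_one_iff.1 ht1
    rw [e]
    have : inducedPlay s j = a := by
      simp only [inducedPlay, e]
      rw [List.getD_append_right _ _ _ _ (by rw [hlen])]
      simp [hlen]
    rw [this]

/-- The play induced in a subgame. -/
theorem sub_play [Inhabited α] {T : Set (List α)} (hT : IsTree T) {s s' : List α → List α}
    (hs : IsProfile T s) {γ : List α} (hγ : γ ∈ T) (hs' : IsProfile {δ | γ ++ δ ∈ T} s') :
    inducedPlay s' ∈ Body {δ | γ ++ δ ∈ T} ∧
    listExtend γ (inducedPlay s') ∈ Body T ∧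
    playPrefix (listExtend γ (inducedPlay s')) γ.length = γ ∧
    ∀ n, γ.length ≤ n → (∃ δ, γ ++ δ ∈ T ∧ playPrefix (listExtend γ (inducedPlay s')) n = γ ++ δ ∧
      (subProfile γ s δ = s' δ → playPrefix (listExtend γ (inducedPlay s')) (n+1) =
        s (playPrefix (listExtend γ (inducedPlay s')) n))) := by
  have h0 : [] ∈ {δ | γ ++ δ ∈ T} := by simpa using hγ
  have hb : inducedPlay s' ∈ Body {δ | γ ++ δ ∈ T} := fun n => by
    have := induced_prefix hs' h0 n
    rw [this.2]; exact this.1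
  refine ⟨hb, listExtend_body hT hb, by simpa [playPrefix] using listExtend_prefix γ (inducedPlay s') 0, ?_⟩
  intro n hn
  obtain ⟨j, rfl⟩ := Nat.exists_eq_add_of_le hn
  have h1 := induced_prefix hs' h0 j
  have h2 := induced_prefix hs' h0 (j+1)
  refine ⟨iterNode s' [] j, h1.1, by rw [listExtend_prefix, h1.2], fun e => ?_⟩
  rw [add_assoc, listExtend_prefix, listExtend_prefix, h1.2, h2.2]
  show γ ++ s' (iterNode s' [] j) = _
  rw [← e, subProfile]
  have h3 := (hs _ h1.1).2.1
  have h4 : γ <+: s (γ ++ iterNode s' [] j) := (List.prefix_append _ _).trans h3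
  obtain ⟨t, ht⟩ := h4
  rw [← ht]; simp

theorem subProfile_profile {T : Set (List α)} {s : List α → List α}
    (hs : IsProfile T s) (γ : List α) : IsProfile {δ | γ ++ δ ∈ T} (subProfile γ s) := by
  intro δ hδ
  obtain ⟨h1, ⟨t, ht⟩, h3⟩ := hs _ hδ
  have e : subProfile γ s δ = δ ++ t := by
    rw [subProfile, ← ht, List.append_assoc]; simp
  rw [e]
  refine ⟨?_, List.prefix_append _ _, ?_⟩
  · show γ ++ (δ ++ t) ∈ T
    rw [← List.append_assoc, ht]; exact h1
  · rw [← ht] at h3; simp at h3 ⊢; omega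

/-- The global strategy. -/
theorem glob [Inhabited α] {T : Set (List α)} (hT : IsTree T) (hpr : IsPruned T)
    (d : List α → Bool) (N : ℕ) (V : (ℕ → α) → ℕ) (hV : ∀ p, V p ≤ N)
    (hm : ∀ i, @MeasurableSet (ℕ → α) (MeasurableSpace.generateFrom {A | IsOpenIn T A})
      {p ∈ Body T | V p ≤ i})
    (hy : ∃ U C, IsOpenIn T U ∧ IsClosedIn T C ∧ {p ∈ Body T | V p = 0} = U ∪ C) :
    ∃ (w : List α → ℕ) (s : List α → List α), IsProfile T s ∧
      (∀ p ∈ Body T, ∀ m, (∀ n, m ≤ n → d (playPrefix p n) = true →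
        playPrefix p (n+1) = s (playPrefix p n)) → V p ≠ 0 → V p ≤ w (playPrefix p m)) ∧
      (∀ p ∈ Body T, ∀ m, (∀ n, m ≤ n → d (playPrefix p n) = false →
        playPrefix p (n+1) = s (playPrefix p n)) → V p ≠ 0 → w (playPrefix p m) ≤ V p) ∧
      (∀ p ∈ Body T, ∀ m, (∀ n, m ≤ n → playPrefix p (n+1) = s (playPrefix p n)) →
        ∀ q ∈ Body T, playPrefix q m = playPrefix p m → V q ≠ 0 → V p ≠ 0) := by
  classical
  obtain ⟨U, C, ⟨SU, hSU, hU⟩, ⟨hC1, SC, hSC, hC2⟩, hUC⟩ := hy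
  let T' : Set (List α) := {γ | ∃ p ∈ Body T, playPrefix p γ.length = γ ∧ V p ≠ 0}
  have hsub : T' ⊆ T := by
    rintro γ ⟨p, hp, h, -⟩
    rw [← h]; exact hp _
  have hbody : ∀ p ∈ Body T, V p ≠ 0 → p ∈ Body T' := fun p hp h n =>
    ⟨p, hp, by rw [length_playPrefix], h⟩
  have hbody' : ∀ p ∈ Body T', p ∈ Body T := fun p hp n => hsub (hp n)
  have hT' : IsTree T' := by
    rintro γ δ h ⟨p, hp, h1, h2⟩
    exact ⟨p, hp, prefix_playPrefix (n := δ.length) (by rw [h1]; exact h), h2⟩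
  have hpr' : IsPruned T' := by
    rintro γ ⟨p, hp, h1, h2⟩
    have := playPrefix_mem_succ (hbody p hp h2) γ.length
    rw [h1] at this
    exact ⟨_, this⟩
  let F : Set (List α) := {γ | γ ∈ T' ∧ ∀ p ∈ Body T', playPrefix p γ.length = γ → V p ≠ 0}
  have hF1 : ∀ p ∈ Body T', V p ≠ 0 → ∃ n, playPrefix p n ∈ F := by
    intro p hp h
    have hpT := hbody' p hp
    have hpC : p ∈ Body T \ C := ⟨hpT, fun hc => by
      have : p ∈ {p ∈ Body T | V p = 0} := by rw [hUC]; exact Or.inr hc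
      exact h this.2⟩
    rw [hC2] at hpC
    simp only [Set.mem_iUnion] at hpC
    obtain ⟨σ, hσ, hpσ⟩ := hpC
    refine ⟨σ.length, hp _, fun q hq hqe hq0 => ?_⟩
    rw [length_playPrefix, hpσ.2] at hqe
    have hqC : q ∈ Body T \ C := by
      rw [hC2]; simp only [Set.mem_iUnion]
      exact ⟨σ, hσ, hbody' q hq, hqe⟩
    have hqU : q ∈ U ∪ C := by rw [← hUC]; exact ⟨hbody' q hq, hq0⟩
    have hqU' := hqU.resolve_right hqC.2
    rw [hU] at hqU'
    simp only [Set.mem_iUnion] at hqU'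
    obtain ⟨ρ, hρ, hqρ⟩ := hqU'
    obtain ⟨r, hr, hr1, hr2⟩ := hq ρ.length
    rw [hqρ.2] at hr1
    have : r ∈ {p ∈ Body T | V p = 0} := by
      rw [hUC]; left; rw [hU]; simp only [Set.mem_iUnion]
      exact ⟨ρ, hρ, hr, hr1⟩
    exact hr2 this.2
  have hFup : ∀ γ ∈ F, ∀ δ ∈ treeSucc T' γ, δ ∈ F := by
    intro γ hγ δ hδ
    refine ⟨hδ.1, fun p hp h => hγ.2 p hp (prefix_playPrefix (n := δ.length) (by rw [h]; exact hδ.2.1))⟩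
  have hF0 : ∀ p ∈ Body T', ∀ n, playPrefix p n ∈ F → V p ≠ 0 := fun p hp n h =>
    h.2 p hp (by rw [length_playPrefix])
  have hF2 : ∀ γ ∈ T', ∃ k, Rch (fun γ δ => δ ∈ treeSucc T' γ) F T' k γ := by
    rintro γ ⟨p, hp, h1, h2⟩
    have hp' := hbody p hp h2
    obtain ⟨n, hn⟩ := hF1 p hp' h2
    have hup : ∀ j, playPrefix p (n + j) ∈ F := by
      intro j
      induction j with
      | zero => exact hn
      | succ j ih => exact hFup _ ih _ (playPrefix_mem_succ hp' _)
    have hr : ∀ j m, n ≤ m + j → Rch (fun γ δ => δ ∈ treeSucc T' γ) F T' j (playPrefix p m) := by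
      intro j
      induction j with
      | zero =>
        intro m hm
        obtain ⟨i, rfl⟩ := Nat.exists_eq_add_of_le (show n ≤ m by omega)
        exact Rch.zero _ (hp' _) (hup i)
      | succ j ih =>
        intro m hm
        exact Rch.succ j _ _ (hp' m) (playPrefix_mem_succ hp' m) (ih (m+1) (by omega))
    refine ⟨n, ?_⟩
    have := hr n γ.length (by omega)
    rwa [h1] at this
  obtain ⟨w, s0, hs0, hA, hB, hAB⟩ := core hsub hT' hpr' d N V hV hm F hFup hF0 hF1 hF2
  have hany : ∀ γ, ∃ δ, γ ∈ T → δ ∈ treeSucc T γ := fun γ => by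
    by_cases h : γ ∈ T
    · obtain ⟨δ, hδ⟩ := hpr γ h; exact ⟨δ, fun _ => hδ⟩
    · exact ⟨γ, fun h' => absurd h' h⟩
  choose any hany using hany
  let s : List α → List α := fun γ => if γ ∈ T' then s0 γ else any γ
  have hsT' : ∀ γ ∈ T', s γ = s0 γ := fun γ h => by simp only [s, h, if_true]
  refine ⟨w, s, ?_, ?_, ?_, ?_⟩
  · intro γ hγ
    by_cases h : γ ∈ T'
    · rw [hsT' γ h]
      exact ⟨hsub (hs0 γ h).1, (hs0 γ h).2⟩
    · simp only [s, h, if_false]; exact hany γ hγ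
  · intro p hp m hf h
    have hp' := hbody p hp h
    exact hA p hp' m (fun n hn hd => by rw [hf n hn hd, hsT' _ (hp' n)]) h
  · intro p hp m hf h
    have hp' := hbody p hp h
    exact hB p hp' m (fun n hn hd => by rw [hf n hn hd, hsT' _ (hp' n)]) h
  · intro p hp m hf q hq hqp hq0
    have hmem : ∀ j, playPrefix p (m + j) ∈ T' := by
      intro j
      induction j with
      | zero => exact ⟨q, hq, by rw [length_playPrefix]; exact hqp, hq0⟩
      | succ j ih =>
        rw [← add_assoc, hf _ (by omega), hsT' _ ih]
        exact (hs0 _ ih).1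
    have hp' : p ∈ Body T' := fun n =>
      hT' (playPrefix_prefix p (show n ≤ m + n by omega)) (hmem n)
    exact hAB p hp' m fun n hn => by rw [hf n hn, hsT' _ (hp' n)]

end BD

/-- a two-player game on a countable pruned tree over a countable alphabet,
with preferences `y <_a x_n <_a ⋯ <_a x_1` and `y <_b x_1 <_b ⋯ <_b x_n`,
Borel-measurable outcome function, and whose set of plays with outcome `y` is a union
of an open and a closed subset of `[T]`, has a global-Pareto subgame perfect equilibrium.
Players: `true = a`, `false = b`; outcomes: `0 = y`, `i = x_i`. -/
theorem stmt6 {α : Type*} [Inhabited α] [Countable α] (n : ℕ)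
    (g : Game α Bool (Fin (n + 1)))
    (hT : IsTree g.T) (hne : g.T.Nonempty) (hpr : IsPruned g.T) (hTc : g.T.Countable)
    (hpa : g.pref true = prefA n) (hpb : g.pref false = prefB n)
    (hBorel : ∀ x : Fin (n + 1), IsBorelIn g.T {p ∈ Body g.T | g.v p = x})
    (hy : ∃ U C, IsOpenIn g.T U ∧ IsClosedIn g.T C ∧
      {p ∈ Body g.T | g.v p = 0} = U ∪ C) :
    ∃ s, IsProfile g.T s ∧ IsGPSPE g s := by
  have hm : ∀ i : ℕ, @MeasurableSet (ℕ → α) (MeasurableSpace.generateFrom {A | IsOpenIn g.T A})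
      {p ∈ Body g.T | (g.v p : ℕ) ≤ i} := by
    intro i
    have e : {p ∈ Body g.T | (g.v p : ℕ) ≤ i} =
        ⋃ x : Fin (n+1), ⋃ _ : (x : ℕ) ≤ i, {p ∈ Body g.T | g.v p = x} := by
      ext p
      simp only [Set.mem_iUnion]
      constructor
      · rintro ⟨h1, h2⟩; exact ⟨g.v p, h2, h1, rfl⟩
      · rintro ⟨x, h1, h2, h3⟩; exact ⟨h2, by rw [h3]; exact h1⟩
    rw [e]
    exact MeasurableSet.iUnion fun x => MeasurableSet.iUnion fun _ => (hBorel x).2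
  have hV0 : ∀ p, (g.v p : ℕ) = 0 ↔ g.v p = 0 := fun p => by
    rw [Fin.ext_iff]; rfl
  obtain ⟨w, s, hs, hA, hB, hAB⟩ := BD.glob hT hpr g.d n (fun p => (g.v p : ℕ))
    (fun p => Nat.lt_succ_iff.1 (g.v p).2) hm (by simpa only [hV0] using hy)
  have base : ∀ γ ∈ g.T, ∀ q ∈ Body {δ | γ ++ δ ∈ g.T}, g.v (listExtend γ q) ≠ 0 →
      g.v (listExtend γ (inducedPlay (subProfile γ s))) ≠ 0 ∧
      (g.v (listExtend γ (inducedPlay (subProfile γ s))) : ℕ) = w γ := by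
    intro γ hγ q hq hq0
    obtain ⟨-, h1, h2, h3⟩ := BD.sub_play hT hs hγ (BD.subProfile_profile hs γ)
    have hf : ∀ n, γ.length ≤ n →
        playPrefix (listExtend γ (inducedPlay (subProfile γ s))) (n+1) =
        s (playPrefix (listExtend γ (inducedPlay (subProfile γ s))) n) := fun n hn => by
      obtain ⟨δ, -, -, h⟩ := h3 n hn
      exact h rfl
    have hq' : playPrefix (listExtend γ q) γ.length = γ := by
      simpa [playPrefix] using BD.listExtend_prefix γ q 0
    have hne0 := hAB _ h1 γ.length hf _ (BD.listExtend_body hT hq) (by rw [hq', h2])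
      (fun h => hq0 ((hV0 _).1 h))
    have hl := hA _ h1 γ.length (fun n hn _ => hf n hn) hne0
    have hr := hB _ h1 γ.length (fun n hn _ => hf n hn) hne0
    rw [h2] at hl hr
    exact ⟨fun h => hne0 ((hV0 _).2 h), le_antisymm hl hr⟩
  refine ⟨s, hs, ?_, ?_⟩
  · rintro γ hγ ⟨c, s', hs', hdiff, hpref⟩
    obtain ⟨h0, h1, h2, h3⟩ := BD.sub_play hT hs hγ hs'
    have hf : ∀ n, γ.length ≤ n → g.d (playPrefix (listExtend γ (inducedPlay s')) n) ≠ c →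
        playPrefix (listExtend γ (inducedPlay s')) (n+1) =
        s (playPrefix (listExtend γ (inducedPlay s')) n) := by
      intro n hn hd
      obtain ⟨δ, e1, e2, h⟩ := h3 n hn
      apply h
      by_contra hne'
      apply hd
      rw [e2]
      exact hdiff δ e1 hne'
    cases c with
    | true =>
      have hp : g.pref true (g.v (listExtend γ (inducedPlay (subProfile γ s))))
        (g.v (listExtend γ (inducedPlay s'))) := hpref
      rw [hpa] at hp
      obtain ⟨b1, b2⟩ := base γ hγ _ h0 hp.1
      have := hB _ h1 γ.length (fun n hn hd => hf n hn (by rw [hd]; decide))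
        (fun h => hp.1 ((hV0 _).1 h))
      rw [h2, ← b2] at this
      rcases hp.2 with h | h
      · exact b1 h
      · exact absurd h (not_lt.2 this)
    | false =>
      have hp : g.pref false (g.v (listExtend γ (inducedPlay (subProfile γ s))))
        (g.v (listExtend γ (inducedPlay s'))) := hpref
      rw [hpb] at hp
      have hp' : g.v (listExtend γ (inducedPlay (subProfile γ s))) <
        g.v (listExtend γ (inducedPlay s')) := hp
      have hne' : g.v (listExtend γ (inducedPlay s')) ≠ 0 := Fin.ne_zero_of_lt hp'
      obtain ⟨b1, b2⟩ := base γ hγ _ h0 hne'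
      have := hA _ h1 γ.length (fun n hn hd => hf n hn (by rw [hd]; decide))
        (fun h => hne' ((hV0 _).1 h))
      rw [h2, ← b2] at this
      exact absurd hp' (not_lt.2 this)
  · intro γ hγ
    obtain ⟨h0, -, -, -⟩ := BD.sub_play hT hs hγ (BD.subProfile_profile hs γ)
    refine ⟨⟨_, h0, rfl⟩, ?_⟩
    rintro _ ⟨q, hq, rfl⟩ c hp
    have hp1 : g.pref c (g.v (listExtend γ (inducedPlay (subProfile γ s))))
      (g.v (listExtend γ q)) := hp
    cases c with
    | true =>
      rw [hpa] at hp1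
      obtain ⟨b1, -⟩ := base γ hγ q hq hp1.1
      refine ⟨false, ?_⟩
      show g.pref false (g.v (listExtend γ q)) (g.v (listExtend γ (inducedPlay (subProfile γ s))))
      rw [hpb]
      exact hp1.2.resolve_left b1
    | false =>
      rw [hpb] at hp1
      have hp' : g.v (listExtend γ (inducedPlay (subProfile γ s))) < g.v (listExtend γ q) := hp1
      obtain ⟨b1, -⟩ := base γ hγ q hq (Fin.ne_zero_of_lt hp')
      refine ⟨true, ?_⟩
      show g.pref true (g.v (listExtend γ q)) (g.v (listExtend γ (inducedPlay (subProfile γ s))))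
      rw [hpa]
      exact ⟨b1, Or.inr hp'⟩
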